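/- Let n ≥ 1 and let F, G ∈ C_c^∞(ℝ^{2n}). Then ‖{F,G}‖ = liminf of ‖{F',G'}‖ as F',G' → F,G in the uniform norm. Precisely, the nontrivial inequality is lower semicontinuity: for every ε > 0 there exists δ > 0 such that every pair F', G' ∈ C_c^∞(ℝ^{2n}) with ‖F' − F‖ < δ and ‖G' − G‖ < δ satisfies ‖{F',G'}‖ > ‖{F,G}‖ − ε. (The opposite inequality is witnessed by F' = F, G' = G.) -/

import Mathlib

/-- The phase space `ℝ^{2n} = ℝ^n × ℝ^n` with coordinates `(p, q)`. -/
abbrev Phase (n : ℕ) := (Fin n → ℝ) × (Fin n → ℝ)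

/-- Partial derivative `∂F/∂p_i`. -/
noncomputable def pderivP {n : ℕ} (F : Phase n → ℝ) (i : Fin n) (x : Phase n) : ℝ :=
  fderiv ℝ F x (Pi.single i 1, 0)

/-- Partial derivative `∂F/∂q_i`. -/
noncomputable def pderivQ {n : ℕ} (F : Phase n → ℝ) (i : Fin n) (x : Phase n) : ℝ :=
  fderiv ℝ F x (0, Pi.single i 1)

/-- The standard Poisson bracket
`{F,G} = Σ i, (∂F/∂q_i · ∂G/∂p_i − ∂F/∂p_i · ∂G/∂q_i)`. -/
noncomputable def poisson {n : ℕ} (F G : Phase n → ℝ) (x : Phase n) : ℝ :=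
  ∑ i : Fin n, (pderivQ F i x * pderivP G i x - pderivP F i x * pderivQ G i x)

/-- `F ∈ C_c^∞(ℝ^{2n})`: smooth and compactly supported. -/
def SmoothCpt {n : ℕ} (F : Phase n → ℝ) : Prop :=
  ContDiff ℝ (⊤ : ℕ∞) F ∧ HasCompactSupport F

/-- The uniform (C⁰) norm `‖F‖ = sup_x |F x|`. -/
noncomputable def unif {n : ℕ} (F : Phase n → ℝ) : ℝ := ⨆ x, |F x|


open MeasureTheory Polynomial in
lemma br_det_interp {W : Type*} [NormedAddCommGroup W] [InnerProductSpace ℝ W]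
    [FiniteDimensional ℝ W] (s : Finset ℝ) (hs : Module.finrank ℝ W < s.card)
    (A : W →L[ℝ] W) :
    (1 + A).det = ∑ i ∈ s, (1 + i • A).det * (Lagrange.basis s id i).eval 1 := by
  classical
  let b := Module.finBasis ℝ W
  let M := LinearMap.toMatrix b b (A : W →ₗ[ℝ] W)
  let p : ℝ[X] := ((X : ℝ[X]) • M.map C + (1 : Matrix _ _ ℝ).map C).det
  have hp : ∀ t : ℝ, p.eval t = (1 + t • A).det := by
    intro t
    have h1 : (1 + t • A).det = (1 + t • M).det := by
      unfold ContinuousLinearMap.det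
      rw [← LinearMap.det_toMatrix b]
      congr 1
      simp only [M]
      rw [← map_smul, ← LinearMap.toMatrix_one b, ← map_add]
      rfl
    rw [h1]
    simp only [p]
    rw [← Polynomial.coe_evalRingHom, RingHom.map_det]
    congr 1
    ext i j
    by_cases hij : i = j <;> simp [hij] <;> ring
  have hdeg : p.degree < s.card := by
    have := Polynomial.natDegree_det_X_add_C_le M (1 : Matrix _ _ ℝ)
    rw [Fintype.card_fin] at this
    refine lt_of_le_of_lt Polynomial.degree_le_natDegree ?_
    exact_mod_cast lt_of_le_of_lt this hs
  have h := Lagrange.eq_interpolate (s := s) (v := id) (f := p) Function.injective_id.injOn hdeg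
  have h1 := hp 1
  rw [one_smul] at h1
  rw [← h1]
  conv_lhs => rw [h]
  rw [Lagrange.interpolate_apply, Polynomial.eval_finsetSum]
  refine Finset.sum_congr rfl fun i _ => ?_
  simp [hp]

lemma br_det_ne {W : Type*} [NormedAddCommGroup W] [InnerProductSpace ℝ W]
    [FiniteDimensional ℝ W] (A : W →L[ℝ] W) (hA : ‖A‖ < 1) : (1 + A).det ≠ 0 := by
  intro h0
  obtain ⟨v, hv, hv0⟩ := LinearMap.bot_lt_ker_of_det_eq_zero h0 |> Submodule.exists_mem_ne_zero_of_ne_bot ∘ ne_of_gt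
  have h1 : v + A v = 0 := by simpa using hv
  have h2 : ‖v‖ = ‖A v‖ := by rw [eq_neg_of_add_eq_zero_left h1, norm_neg]; 
                              rw [← eq_neg_of_add_eq_zero_left h1]
  have h3 := A.le_opNorm v
  have h4 : 0 < ‖v‖ := norm_pos_iff.2 hv0
  nlinarith

lemma br_det_pos {W : Type*} [NormedAddCommGroup W] [InnerProductSpace ℝ W]
    [FiniteDimensional ℝ W] (A : W →L[ℝ] W) (hA : ‖A‖ < 1) : 0 < (1 + A).det := by
  by_contra hneg
  push Not at hneg
  have hc : Continuous (fun t : ℝ => (1 + t • A).det) :=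
    ContinuousLinearMap.continuous_det.comp (by fun_prop)
  have h := intermediate_value_Icc' (zero_le_one (α := ℝ)) hc.continuousOn
  have h0 : (0 : ℝ) ∈ Set.Icc ((1 + (1 : ℝ) • A).det) ((1 + (0 : ℝ) • A).det) := by
    refine ⟨by simpa using hneg, ?_⟩
    rw [zero_smul, add_zero]
    have : (1 : W →L[ℝ] W).det = 1 := by
      unfold ContinuousLinearMap.det
      exact LinearMap.det_id
    rw [this]; exact zero_le_one
  obtain ⟨t, ht, ht0⟩ := h h0
  refine br_det_ne (t • A) ?_ ht0
  rw [norm_smul, Real.norm_eq_abs, abs_of_nonneg ht.1]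
  nlinarith [norm_nonneg A, ht.2]

open MeasureTheory in
lemma br_no_retraction {W : Type*} [NormedAddCommGroup W] [InnerProductSpace ℝ W]
    [FiniteDimensional ℝ W] (r : W → W) (hr : ContDiff ℝ 1 r) (R : ℝ) (hR : 0 < R)
    (hn : ∀ x, ‖r x‖ = R) (hid : ∀ x, ‖x‖ = R → r x = x) : False := by
  classical
  let _ : MeasurableSpace W := borel W
  have _ : BorelSpace W := ⟨rfl⟩
  let g : W → W := fun x => r x - x
  have hg : ContDiff ℝ 1 g := hr.sub contDiff_id
  have hgd : ∀ x, HasFDerivAt g (fderiv ℝ g x) x := fun x =>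
    (hg.differentiable one_ne_zero x).hasFDerivAt
  have hgc : Continuous (fderiv ℝ g) := hg.continuous_fderiv one_ne_zero
  obtain ⟨K, hK⟩ := (isCompact_closedBall (0 : W) R).exists_bound_of_continuousOn
    hgc.continuousOn
  have hK0 : 0 ≤ K := (norm_nonneg _).trans (hK 0 (Metric.mem_closedBall_self hR.le))
  let g' : W → W := fun x => if ‖x‖ ≤ R then g x else 0
  have hLip : ∀ x y, ‖x‖ ≤ R → ‖y‖ ≤ R → ‖g x - g y‖ ≤ K * ‖x - y‖ := by
    intro x y hx hy
    refine (convex_closedBall (0 : W) R).norm_image_sub_le_of_norm_fderiv_le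
      (fun z _ => hg.differentiable one_ne_zero z) hK ?_ ?_ <;> simpa using ‹_›
  have hmix : ∀ x y, ‖x‖ ≤ R → R < ‖y‖ → ‖g x‖ ≤ K * ‖x - y‖ := by
    intro x y hx hy
    have hc : Continuous (fun t : ℝ => ‖x + t • (y - x)‖) := by fun_prop
    have h := intermediate_value_Icc (zero_le_one (α := ℝ)) hc.continuousOn
    obtain ⟨t, ht, ht0⟩ := h (show R ∈ _ from ⟨by simpa using hx, by simpa using hy.le⟩)
    have h2 : g (x + t • (y - x)) = 0 := by simp only [g]; rw [hid _ ht0, sub_self]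
    have h3 := hLip x _ hx ht0.le
    rw [h2, sub_zero] at h3
    refine h3.trans (mul_le_mul_of_nonneg_left ?_ hK0)
    rw [sub_add_cancel_left, norm_neg, norm_smul, Real.norm_eq_abs, abs_of_nonneg ht.1,
      norm_sub_rev]
    exact mul_le_of_le_one_left (norm_nonneg _) ht.2
  have hLip' : ∀ x y, ‖g' x - g' y‖ ≤ K * ‖x - y‖ := by
    intro x y
    simp only [g']
    split_ifs with h1 h2 h2
    · exact hLip x y h1 h2
    · rw [sub_zero]; exact hmix x y h1 (not_le.1 h2)
    · rw [zero_sub, norm_neg, norm_sub_rev x y]; exact hmix y x h2 (not_le.1 h1)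
    · simp; positivity
  have key : ∀ t : ℝ, 0 ≤ t → t * K < 1 →
      ∫ x in Metric.ball (0 : W) R, (1 + t • fderiv ℝ g x).det
        = (volume (Metric.ball (0 : W) R)).toReal := by
    intro t ht0 ht
    let f : W → W := fun x => x + t • g' x
    have hinj : Function.Injective f := by
      intro x y hxy
      have h1 : x - y = - (t • (g' x - g' y)) := by
        have : x + t • g' x = y + t • g' y := hxy
        rw [smul_sub]
        have h2 : x - y = t • g' y - t • g' x := by
          rw [sub_eq_sub_iff_add_eq_add, this, add_comm]
        rw [h2]; abel
      have h2 : ‖x - y‖ ≤ t * (K * ‖x - y‖) := by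
        conv_lhs => rw [h1]
        rw [norm_neg, norm_smul, Real.norm_eq_abs, abs_of_nonneg ht0]
        exact mul_le_mul_of_nonneg_left (hLip' x y) ht0
      by_contra hne
      have : 0 < ‖x - y‖ := norm_pos_iff.2 (sub_ne_zero.2 hne)
      nlinarith
    have hsurj : Function.Surjective f := by
      have hA : ApproximatesLinearOn f ((ContinuousLinearEquiv.refl ℝ W : W ≃L[ℝ] W) : W →L[ℝ] W)
          Set.univ ⟨t * K, mul_nonneg ht0 hK0⟩ := by
        intro x _ y _
        simp only [f, ContinuousLinearEquiv.coe_refl, ContinuousLinearMap.coe_id', id]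
        have : x + t • g' x - (y + t • g' y) - (x - y) = t • (g' x - g' y) := by
          rw [smul_sub]; abel
        rw [this, norm_smul, Real.norm_eq_abs, abs_of_nonneg ht0]
        show _ ≤ t * K * ‖x - y‖
        rw [mul_assoc]
        exact mul_le_mul_of_nonneg_left (hLip' x y) ht0
      refine hA.surjective ?_
      by_cases hsub : Subsingleton W
      · exact Or.inl hsub
      · right
        have _ : Nontrivial W := not_subsingleton_iff_nontrivial.1 hsub
        have h1 : ‖(((ContinuousLinearEquiv.refl ℝ W).symm : W ≃L[ℝ] W) : W →L[ℝ] W)‖₊ = 1 := by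
          ext
          simp
        rw [h1, inv_one]
        exact ht
    have hout : ∀ x, R ≤ ‖x‖ → f x = x := by
      intro x hx
      simp only [f, g']
      split_ifs with h
      · simp only [g]; rw [hid x (le_antisymm h hx), sub_self, smul_zero, add_zero]
      · simp
    have himg : Set.image f (Metric.ball (0 : W) R) = Metric.ball (0 : W) R := by
      ext y
      simp only [Set.mem_image, mem_ball_zero_iff]
      constructor
      · rintro ⟨x, hx, rfl⟩
        by_contra h
        push Not at h
        have := hinj (hout _ h)
        rw [this] at h
        linarith
      · intro hy
        obtain ⟨x, rfl⟩ := hsurj y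
        refine ⟨x, ?_, rfl⟩
        by_contra h
        push Not at h
        rw [hout x h] at hy
        linarith
    have hder : ∀ x ∈ Metric.ball (0 : W) R,
        HasFDerivWithinAt f (1 + t • fderiv ℝ g x) (Metric.ball (0 : W) R) x := by
      intro x hx
      have h1 : HasFDerivAt (fun x => x + t • g x) (1 + t • fderiv ℝ g x) x :=
        (hasFDerivAt_id x).add ((hgd x).const_smul t)
      refine h1.hasFDerivWithinAt.congr ?_ ?_
      · intro y hy
        simp only [f, g']
        rw [if_pos (mem_ball_zero_iff.1 hy).le]
      · simp only [f, g']
        rw [if_pos (mem_ball_zero_iff.1 hx).le]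
    have h := lintegral_abs_det_fderiv_eq_addHaar_image (volume : Measure W)
      measurableSet_ball hder hinj.injOn
    rw [himg] at h
    rw [integral_eq_lintegral_of_nonneg_ae]
    · rw [← h]
      congr 1
      refine setLIntegral_congr_fun measurableSet_ball fun x hx => ?_
      rw [abs_of_pos]
      refine br_det_pos _ ?_
      rw [norm_smul, Real.norm_eq_abs, abs_of_nonneg ht0]
      exact lt_of_le_of_lt (mul_le_mul_of_nonneg_left
        (hK x (Metric.ball_subset_closedBall hx)) ht0) ht
    · filter_upwards [ae_restrict_mem measurableSet_ball] with x hx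
      refine (br_det_pos _ ?_).le
      rw [norm_smul, Real.norm_eq_abs, abs_of_nonneg ht0]
      exact lt_of_le_of_lt (mul_le_mul_of_nonneg_left
        (hK x (Metric.ball_subset_closedBall hx)) ht0) ht
    · refine Continuous.aestronglyMeasurable ?_
      exact ContinuousLinearMap.continuous_det.comp
        (continuous_const.add (hgc.const_smul t))
  have hdet0 : ∀ x, (1 + fderiv ℝ g x).det = 0 := by
    intro x
    by_contra hne
    have hrd : HasFDerivAt r (1 + fderiv ℝ g x) x := by
      have h1 : HasFDerivAt (fun x => x + g x) (1 + fderiv ℝ g x) x :=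
        (hasFDerivAt_id x).add (hgd x)
      refine h1.congr_of_eventuallyEq (Filter.Eventually.of_forall fun y => ?_)
      simp [g]
    have h2 := hrd.norm_sq
    have h3 : HasFDerivAt (fun y => ‖r y‖ ^ 2) (0 : W →L[ℝ] ℝ) x := by
      simp only [hn]; exact hasFDerivAt_const _ _
    have h4 := h2.unique h3
    have hs : Function.Surjective (1 + fderiv ℝ g x : W →L[ℝ] W) := by
      have := LinearMap.equivOfDetNeZero _ hne |>.surjective
      exact this
    obtain ⟨v, hv⟩ := hs (r x)
    have h5 := congrArg (fun L : W →L[ℝ] ℝ => L v) h4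
    simp at h5
    have h6 : v + (fderiv ℝ g x) v = r x := hv
    rw [← mul_add, ← inner_add_right, h6] at h5
    rw [real_inner_self_eq_norm_sq, hn] at h5
    nlinarith [sq_pos_of_pos hR]
  -- interpolation
  let d := Module.finrank ℝ W
  let s : Finset ℝ := (Finset.range (d + 1)).image (fun i : ℕ => (i : ℝ) / ((d + 1) * (K + 1)))
  have hpos : (0 : ℝ) < (d + 1) * (K + 1) := by positivity
  have hs : d < s.card := by
    rw [Finset.card_image_of_injective]
    · simp
    · intro i j hij
      simp only at hij
      rw [div_left_inj' hpos.ne'] at hij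
      exact_mod_cast hij
  have hsK : ∀ t ∈ s, 0 ≤ t ∧ t * K < 1 := by
    intro t ht
    obtain ⟨i, hi, rfl⟩ := Finset.mem_image.1 ht
    refine ⟨by positivity, ?_⟩
    have hi' : (i : ℝ) < d + 1 := by exact_mod_cast Finset.mem_range.1 hi
    rw [div_mul_eq_mul_div, div_lt_one hpos]
    nlinarith
  have hIntOn : ∀ t : ℝ, IntegrableOn (fun x => (1 + t • fderiv ℝ g x).det) (Metric.ball (0 : W) R) := by
    intro t
    refine (Continuous.continuousOn ?_).integrableOn_compact (isCompact_closedBall (0 : W) R)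
      |>.mono_set Metric.ball_subset_closedBall
    exact ContinuousLinearMap.continuous_det.comp
        (continuous_const.add (hgc.const_smul t))
  have hsum : ∫ x in Metric.ball (0 : W) R, (1 + fderiv ℝ g x).det
      = (volume (Metric.ball (0 : W) R)).toReal := by
    have h1 : ∀ x, (1 + fderiv ℝ g x).det = ∑ i ∈ s, (1 + i • fderiv ℝ g x).det *
        (Lagrange.basis s id i).eval 1 := fun x => br_det_interp s hs _
    simp only [h1]
    rw [integral_finsetSum]
    · have h2 : ∀ i ∈ s, ∫ x in Metric.ball (0 : W) R, (1 + i • fderiv ℝ g x).det *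
        (Lagrange.basis s id i).eval 1 = (volume (Metric.ball (0 : W) R)).toReal *
          (Lagrange.basis s id i).eval 1 := by
        intro i hi
        rw [integral_mul_const, key i (hsK i hi).1 (hsK i hi).2]
      rw [Finset.sum_congr rfl h2, ← Finset.mul_sum, ← Polynomial.eval_finsetSum,
        Lagrange.sum_basis Function.injective_id.injOn (Finset.card_pos.1 (by omega))]
      simp
    · intro i _
      exact (hIntOn i).mul_const _
  simp only [hdet0, integral_zero] at hsum
  have hv : 0 < (volume (Metric.ball (0 : W) R)).toReal :=
    ENNReal.toReal_pos (Metric.measure_ball_pos _ _ hR).ne' measure_ball_lt_top.ne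
  linarith

lemma br_hit {W : Type*} [NormedAddCommGroup W] [InnerProductSpace ℝ W]
    [FiniteDimensional ℝ W] (f : W → W) (hf : ContDiff ℝ 1 f) (B : ℝ)
    (hB : ∀ x, ‖f x - x‖ ≤ B) : ∃ x, f x = 0 := by
  by_contra hne
  push Not at hne
  have hB0 : 0 ≤ B := (norm_nonneg _).trans (hB 0)
  let χ : ContDiffBump (0 : W) := ⟨B + 1, B + 2, by positivity, by linarith⟩
  let u : W → W := fun x => x + χ x • (f x - x)
  have hu : ContDiff ℝ 1 u := contDiff_id.add (χ.contDiff.smul (hf.sub contDiff_id))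
  have hu0 : ∀ x, u x ≠ 0 := by
    intro x h
    by_cases hx : ‖x‖ ≤ B + 1
    · have : χ x = 1 := χ.one_of_mem_closedBall (by simpa using hx)
      simp only [u, this, one_smul] at h
      exact hne x (by simpa using h)
    · push Not at hx
      have h1 : x = - (χ x • (f x - x)) := eq_neg_of_add_eq_zero_left h
      have h2 : ‖x‖ ≤ B := by
        rw [h1, norm_neg, norm_smul, Real.norm_eq_abs, abs_of_nonneg χ.nonneg]
        nlinarith [hB x, χ.le_one (x := x), norm_nonneg (f x - x), χ.nonneg (x := x)]
      linarith
  have hpos : ∀ x, 0 < ‖u x‖ := fun x => norm_pos_iff.2 (hu0 x)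
  refine br_no_retraction (fun x => ((B + 2) * ‖u x‖⁻¹) • u x) ?_ (B + 2) (by positivity) ?_ ?_
  · exact (contDiff_const.mul ((hu.norm ℝ hu0).inv fun x => (hpos x).ne')).smul hu
  · intro x
    rw [norm_smul, norm_mul, norm_inv, norm_norm, Real.norm_of_nonneg (by positivity), mul_assoc,
      inv_mul_cancel₀ (hpos x).ne', mul_one]
  · intro x hx
    have h1 : χ x = 0 := χ.zero_of_le_dist (by simp [hx, χ])
    have h2 : u x = x := by simp [u, h1]
    simp only [h2]
    rw [hx, mul_inv_cancel₀ (by positivity), one_smul]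

/-- `S` can be pushed below level `α` along a `C¹` map at bounded distance from `j`. -/
def Lev {W E : Type*} [NormedAddCommGroup W] [NormedSpace ℝ W] [NormedAddCommGroup E]
    [NormedSpace ℝ E] (j : W → E) (S : E → ℝ) (α : ℝ) : Prop :=
  ∃ h : W → E, ContDiff ℝ 1 h ∧ (∃ B, ∀ x, ‖h x - j x‖ ≤ B) ∧ ∀ x, S (h x) ≤ α

section levels

variable {W E : Type*} [NormedAddCommGroup W] [NormedSpace ℝ W] [NormedAddCommGroup E]
    [InnerProductSpace ℝ E] [FiniteDimensional ℝ E]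

/-- One damped gradient step. -/
lemma lev_descent (S : E → ℝ) (hS : ContDiff ℝ 2 S) (L : ℝ)
    (hL : ∀ x y, ‖fderiv ℝ S x - fderiv ℝ S y‖ ≤ L * ‖x - y‖) (ε : ℝ) (hε : 0 < ε)
    (hLε : L * ε ≤ 1 / 2) :
    ∃ σ : E → E, ContDiff ℝ 1 σ ∧ (∀ z, ‖σ z - z‖ ≤ ε) ∧
      ∀ z, S (σ z) ≤ S z - ε / 2 * (‖fderiv ℝ S z‖ ^ 2 / (1 + ‖fderiv ℝ S z‖ ^ 2)) := by
  let g : E → E := fun z => (InnerProductSpace.toDual ℝ E).symm (fderiv ℝ S z)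
  have hgn : ∀ z, ‖g z‖ = ‖fderiv ℝ S z‖ := fun z => LinearIsometryEquiv.norm_map _ _
  have hgC : ContDiff ℝ 1 g :=
    (InnerProductSpace.toDual ℝ E).symm.contDiff.comp (hS.fderiv_right (m := 1) (by norm_num))
  have hgi : ∀ z w, fderiv ℝ S z w = inner ℝ (g z) w := by
    intro z w
    simp only [g]
    rw [InnerProductSpace.toDual_symm_apply]
  let v : E → E := fun z => (1 + ‖g z‖ ^ 2)⁻¹ • g z
  have hp : ∀ z, 0 < 1 + ‖g z‖ ^ 2 := fun z => by positivity
  have hvC : ContDiff ℝ 1 v :=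
    ((contDiff_const.add (hgC.norm_sq ℝ)).inv fun z => (hp z).ne').smul hgC
  have hvn : ∀ z, ‖v z‖ = ‖g z‖ / (1 + ‖g z‖ ^ 2) := by
    intro z
    simp only [v]
    rw [norm_smul, norm_inv, Real.norm_of_nonneg (hp z).le, inv_mul_eq_div]
  have hv1 : ∀ z, ‖v z‖ ≤ 1 := by
    intro z
    rw [hvn, div_le_one (hp z)]
    nlinarith [sq_nonneg (‖g z‖ - 1), norm_nonneg (g z)]
  refine ⟨fun z => z - ε • v z, contDiff_id.sub (hvC.const_smul ε), ?_, ?_⟩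
  · intro z
    rw [sub_sub_cancel_left, norm_neg, norm_smul, Real.norm_of_nonneg hε.le]
    exact mul_le_of_le_one_right hε.le (hv1 z)
  · intro z
    rw [← hgn]
    set y := z - ε • v z with hy
    have hyz : y - z = -(ε • v z) := by rw [hy]; abel
    have hyn : ‖y - z‖ = ε * ‖v z‖ := by
      rw [hyz, norm_neg, norm_smul, Real.norm_of_nonneg hε.le]
    have hL0 : 0 ≤ L * ‖y - z‖ := (norm_nonneg _).trans (hL y z)
    have hmv : ‖S y - S z - fderiv ℝ S z (y - z)‖ ≤ (L * ‖y - z‖) * ‖y - z‖ := by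
      refine (convex_segment z y).norm_image_sub_le_of_norm_fderiv_le' (𝕜 := ℝ)
        (fun x _ => hS.differentiable two_ne_zero x) ?_ (left_mem_segment ℝ z y)
        (right_mem_segment ℝ z y)
      intro x hx
      have hx' : ‖x - z‖ ≤ ‖y - z‖ := by
        obtain ⟨t, ht, rfl⟩ := (segment_eq_image' ℝ z y ▸ hx)
        rw [add_sub_cancel_left, norm_smul, Real.norm_of_nonneg ht.1]
        exact mul_le_of_le_one_left (norm_nonneg _) ht.2
      refine (hL x z).trans ?_
      by_cases hLs : 0 ≤ L
      · exact mul_le_mul_of_nonneg_left hx' hLs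
      · push Not at hLs
        have h0 : ‖y - z‖ = 0 := by
          have := norm_nonneg (y - z)
          nlinarith
        have h1 : ‖x - z‖ = 0 := le_antisymm (h0 ▸ hx') (norm_nonneg _)
        rw [h0, h1]
    have h1 := (abs_le.1 hmv).2
    have h2 : fderiv ℝ S z (y - z) = - (ε * (‖g z‖ ^ 2 / (1 + ‖g z‖ ^ 2))) := by
      rw [hgi, hyz, inner_neg_right, inner_smul_right]
      simp only [v]
      rw [inner_smul_right, real_inner_self_eq_norm_sq]
      ring
    have h3 : ‖v z‖ ^ 2 ≤ ‖g z‖ ^ 2 / (1 + ‖g z‖ ^ 2) := by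
      rw [hvn, div_pow, div_le_div_iff₀ (pow_pos (hp z) 2) (hp z)]
      have : 1 ≤ 1 + ‖g z‖ ^ 2 := by nlinarith [sq_nonneg ‖g z‖]
      have h4 : 0 ≤ ‖g z‖ ^ 2 := sq_nonneg _
      nlinarith [mul_nonneg (mul_nonneg h4 h4) (hp z).le]
    rw [h2, hyn] at h1
    have h5 : L * (ε * ‖v z‖) * (ε * ‖v z‖) = (L * ε) * ε * ‖v z‖ ^ 2 := by ring
    rw [h5] at h1
    have h6 : (L * ε) * ε * ‖v z‖ ^ 2 ≤ 1 / 2 * ε * ‖v z‖ ^ 2 := by gcongr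
    have h7 : 1 / 2 * ε * ‖v z‖ ^ 2 ≤ 1 / 2 * ε * (‖g z‖ ^ 2 / (1 + ‖g z‖ ^ 2)) := by gcongr
    linarith

lemma lev_step (j : W → E) (L B ν Kb : ℝ) (hL0 : 0 ≤ L) (hB0 : 0 ≤ B) (hν : 0 < ν)
    (hKb : 0 ≤ Kb) :
    ∃ d0 > 0, ∀ (S R : E → ℝ) (K d α : ℝ), |K| ≤ Kb → 0 < d → d ≤ d0 → ContDiff ℝ 2 S →
      (∀ x y, ‖fderiv ℝ S x - fderiv ℝ S y‖ ≤ L * ‖x - y‖) → (∀ y, |R y| ≤ B) →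
      (∀ y, ‖fderiv ℝ S y‖ < ν → R y ≤ K) → Lev j S α →
      Lev j (fun y => S y + d * R y) (α + d * K) := by
  set κ : ℝ := (1 / 2) * ((ν / 2) ^ 2 / (1 + (ν / 2) ^ 2)) with hκ
  have hκ0 : 0 < κ := by positivity
  let m : ℝ := min (1 / 2) (ν / 4)
  have hm : 0 < m := lt_min (by norm_num) (by positivity)
  refine ⟨m * κ / ((L + 1) * (B + Kb + 1)), by positivity, ?_⟩
  intro S R K d α hK hd hd0 hS hL hB hcrit ⟨h, hhC, ⟨Bh, hBh⟩, hhS⟩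
  set ε : ℝ := d * (B + Kb + 1) / κ with hεd
  have hε : 0 < ε := by positivity
  have hLε' : (L + 1) * ε ≤ m := by
    rw [hεd]
    rw [le_div_iff₀ (by positivity)] at hd0
    rw [mul_div_assoc', div_le_iff₀ hκ0]
    linarith
  have hLε : L * ε ≤ m := by nlinarith
  obtain ⟨σ, hσC, hσ1, hσ2⟩ := lev_descent S hS L hL ε hε (hLε.trans (min_le_left _ _))
  refine ⟨fun x => σ (h x), hσC.comp hhC, ⟨ε + Bh, fun x => ?_⟩, fun x => ?_⟩
  · calc ‖σ (h x) - j x‖ = ‖(σ (h x) - h x) + (h x - j x)‖ := by congr 1; abel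
      _ ≤ ε + Bh := (norm_add_le _ _).trans (add_le_add (hσ1 _) (hBh _))
  · set z := h x
    have hd1 := hσ2 z
    have hz := hhS x
    by_cases hc : ‖fderiv ℝ S z‖ < ν / 2
    · have hy : ‖fderiv ℝ S (σ z)‖ < ν := by
        have h1 := hL (σ z) z
        have h2 := norm_le_norm_add_norm_sub' (fderiv ℝ S (σ z)) (fderiv ℝ S z)
        have h3 : L * ‖σ z - z‖ ≤ L * ε := mul_le_mul_of_nonneg_left (hσ1 z) hL0
        have h4 : m ≤ ν / 4 := min_le_right _ _
        linarith
      have h1 := hcrit _ hy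
      have h2 : 0 ≤ ε / 2 * (‖fderiv ℝ S z‖ ^ 2 / (1 + ‖fderiv ℝ S z‖ ^ 2)) := by positivity
      have h3 : d * R (σ z) ≤ d * K := mul_le_mul_of_nonneg_left h1 hd.le
      show S (σ z) + d * R (σ z) ≤ α + d * K
      linarith
    · push Not at hc
      have h1 : (ν / 2) ^ 2 / (1 + (ν / 2) ^ 2) ≤
          ‖fderiv ℝ S z‖ ^ 2 / (1 + ‖fderiv ℝ S z‖ ^ 2) := by
        have : (ν / 2) ^ 2 ≤ ‖fderiv ℝ S z‖ ^ 2 := by gcongr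
        rw [div_le_div_iff₀ (by positivity) (by positivity)]
        nlinarith
      have h2 : ε * κ ≤ ε / 2 * (‖fderiv ℝ S z‖ ^ 2 / (1 + ‖fderiv ℝ S z‖ ^ 2)) := by
        rw [hκ, ← mul_assoc, mul_one_div]
        gcongr
      have h3 : ε * κ = d * (B + Kb + 1) := by rw [hεd]; field_simp
      have h4 : d * R (σ z) ≤ d * B :=
        mul_le_mul_of_nonneg_left (abs_le.1 (hB _)).2 hd.le
      have h5 : - (d * Kb) ≤ d * K := by
        have := mul_le_mul_of_nonneg_left (abs_le.1 hK).1 hd.le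
        linarith
      show S (σ z) + d * R (σ z) ≤ α + d * K
      linarith

/-- Lipschitz bound for the derivative of `Q + r R`. -/
lemma lev_lip (Q R : E → ℝ) (hQ : ContDiff ℝ 2 Q) (hR : ContDiff ℝ 2 R) (LQ LR : ℝ)
    (hLQ : ∀ x y, ‖fderiv ℝ Q x - fderiv ℝ Q y‖ ≤ LQ * ‖x - y‖)
    (hLR : ∀ x y, ‖fderiv ℝ R x - fderiv ℝ R y‖ ≤ LR * ‖x - y‖) (_hLR0 : 0 ≤ LR)
    (s r : ℝ) (hr : 0 ≤ r) (hrs : r ≤ s) (x y : E) :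
    ‖fderiv ℝ (fun y => Q y + r * R y) x - fderiv ℝ (fun y => Q y + r * R y) y‖
      ≤ (LQ + s * LR) * ‖x - y‖ := by
  have hd : ∀ z, fderiv ℝ (fun y => Q y + r * R y) z = fderiv ℝ Q z + r • fderiv ℝ R z := by
    intro z
    rw [fderiv_fun_add (hQ.differentiable two_ne_zero z)
      ((hR.differentiable two_ne_zero z).const_mul r),
      fderiv_const_mul (hR.differentiable two_ne_zero z)]
  rw [hd, hd]
  have : fderiv ℝ Q x + r • fderiv ℝ R x - (fderiv ℝ Q y + r • fderiv ℝ R y)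
      = (fderiv ℝ Q x - fderiv ℝ Q y) + r • (fderiv ℝ R x - fderiv ℝ R y) := by
    rw [smul_sub]; abel
  rw [this]
  refine (norm_add_le _ _).trans ?_
  rw [norm_smul, Real.norm_of_nonneg hr]
  have h1 : r * ‖fderiv ℝ R x - fderiv ℝ R y‖ ≤ s * (LR * ‖x - y‖) :=
    mul_le_mul hrs (hLR x y) (norm_nonneg _) (hr.trans hrs)
  linarith [hLQ x y]

lemma lev_up (j : W → E) (Q R : E → ℝ) (hQ : ContDiff ℝ 2 Q) (hR : ContDiff ℝ 2 R)
    (LQ LR B : ℝ)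
    (hLQ : ∀ x y, ‖fderiv ℝ Q x - fderiv ℝ Q y‖ ≤ LQ * ‖x - y‖)
    (hLR : ∀ x y, ‖fderiv ℝ R x - fderiv ℝ R y‖ ≤ LR * ‖x - y‖)
    (hLQ0 : 0 ≤ LQ) (hLR0 : 0 ≤ LR) (hB0 : 0 ≤ B) (hB : ∀ y, |R y| ≤ B)
    (s ν C η α : ℝ) (hs : 0 < s) (hν : 0 < ν) (hC : 0 ≤ C) (hη : 0 ≤ η)
    (hcrit : ∀ r, 0 ≤ r → r ≤ s → ∀ y, ‖fderiv ℝ (fun y => Q y + r * R y) y‖ < ν →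
      R y ≤ 2 * r * C + η) (h0 : Lev j Q α) :
    Lev j (fun y => Q y + s * R y) (α + s ^ 2 * C + s * η) := by
  obtain ⟨d0, hd0, hstep⟩ := lev_step j (LQ + s * LR) B ν (2 * s * C + η) (by positivity) hB0 hν
    (by positivity)
  obtain ⟨m, hm⟩ := exists_nat_gt (s / d0)
  have hm0 : (0 : ℝ) < m := lt_trans (by positivity) hm
  set d := s / m with hd
  have hdpos : 0 < d := by positivity
  have hdd : d ≤ d0 := by
    rw [hd, div_le_iff₀ hm0]
    rw [div_lt_iff₀ hd0] at hm
    linarith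
  have hmd : m * d = s := by rw [hd]; field_simp
  have hind : ∀ k : ℕ, k ≤ m → Lev j (fun y => Q y + (k * d) * R y)
      (α + (k * d) ^ 2 * C + (k * d) * η) := by
    intro k
    induction k with
    | zero => intro _; simpa using h0
    | succ k ih =>
      intro hk
      have h1 := ih (by omega)
      have hks : (k : ℝ) * d ≤ s := by
        rw [← hmd]
        have : (k : ℝ) ≤ m := by exact_mod_cast (by omega : k ≤ m)
        gcongr
      have hk0 : 0 ≤ (k : ℝ) * d := by positivity
      have h2 := hstep _ R (2 * (k * d) * C + η) d _ ?_ hdpos hdd ?_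
        (lev_lip Q R hQ hR LQ LR hLQ hLR hLR0 s (k * d) hk0 hks) hB (hcrit _ hk0 hks) h1
      · obtain ⟨h, hh1, hh2, hh3⟩ := h2
        refine ⟨h, hh1, hh2, fun x => ?_⟩
        have h3 := hh3 x
        push_cast
        have h4 : 0 ≤ d ^ 2 * C := by positivity
        nlinarith
      · rw [abs_of_nonneg (by positivity)]
        gcongr
      · exact hQ.add (contDiff_const.mul hR)
  have := hind m le_rfl
  rwa [hmd] at this

lemma lev_down (j : W → E) (Q R : E → ℝ) (hQ : ContDiff ℝ 2 Q) (hR : ContDiff ℝ 2 R)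
    (LQ LR B : ℝ)
    (hLQ : ∀ x y, ‖fderiv ℝ Q x - fderiv ℝ Q y‖ ≤ LQ * ‖x - y‖)
    (hLR : ∀ x y, ‖fderiv ℝ R x - fderiv ℝ R y‖ ≤ LR * ‖x - y‖)
    (hLQ0 : 0 ≤ LQ) (hLR0 : 0 ≤ LR) (hB0 : 0 ≤ B) (hB : ∀ y, |R y| ≤ B)
    (s ν A η α : ℝ) (hs : 0 < s) (hν : 0 < ν) (hA : 0 ≤ A) (hη : 0 ≤ η)
    (hcrit : ∀ r, 0 ≤ r → r ≤ s → ∀ y, ‖fderiv ℝ (fun y => Q y + r * R y) y‖ < ν →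
      2 * r * A - η ≤ R y) (h0 : Lev j (fun y => Q y + s * R y) α) :
    Lev j Q (α - s ^ 2 * A + s * η) := by
  obtain ⟨d0, hd0, hstep⟩ := lev_step j (LQ + s * LR) B ν (2 * s * A + η) (by positivity) hB0 hν
    (by positivity)
  obtain ⟨m, hm⟩ := exists_nat_gt (s / d0)
  have hm0 : (0 : ℝ) < m := lt_trans (by positivity) hm
  set d := s / m with hd
  have hdpos : 0 < d := by positivity
  have hdd : d ≤ d0 := by
    rw [hd, div_le_iff₀ hm0]
    rw [div_lt_iff₀ hd0] at hm
    linarith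
  have hmd : m * d = s := by rw [hd]; field_simp
  have hind : ∀ k : ℕ, k ≤ m → Lev j (fun y => Q y + (s - k * d) * R y)
      (α + ((s - k * d) ^ 2 - s ^ 2) * A + (k * d) * η) := by
    intro k
    induction k with
    | zero => intro _; simpa using h0
    | succ k ih =>
      intro hk
      have h1 := ih (by omega)
      have hks : (k : ℝ) * d ≤ s := by
        rw [← hmd]
        have : (k : ℝ) ≤ m := by exact_mod_cast (by omega : k ≤ m)
        gcongr
      have hk0 : 0 ≤ (k : ℝ) * d := by positivity
      have hr0 : 0 ≤ s - k * d := by linarith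
      have hrs : s - k * d ≤ s := by linarith
      have h2 := hstep _ (fun y => - R y) (-(2 * (s - k * d) * A) + η) d _ ?_ hdpos hdd ?_
        (lev_lip Q R hQ hR LQ LR hLQ hLR hLR0 s (s - k * d) hr0 hrs)
        (fun y => by rw [abs_neg]; exact hB y)
        (fun y hy => by have := hcrit _ hr0 hrs y hy; linarith) h1
      · obtain ⟨h, hh1, hh2, hh3⟩ := h2
        refine ⟨h, hh1, hh2, fun x => ?_⟩
        have h3 := hh3 x
        push_cast
        have h4 : 0 ≤ d ^ 2 * A := by positivity
        nlinarith
      · have h5 : 0 ≤ (s - k * d) * A := by positivity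
        have h6 : (s - k * d) * A ≤ s * A := by gcongr
        rw [abs_le]
        constructor <;> linarith
      · exact hQ.add (contDiff_const.mul hR)
  have := hind m le_rfl
  rw [hmd] at this
  obtain ⟨h, hh1, hh2, hh3⟩ := this
  refine ⟨h, hh1, hh2, fun x => ?_⟩
  have h3 := hh3 x
  simp only [sub_self, zero_mul, add_zero] at h3
  linarith

end levels

lemma lev_mono {W E : Type*} [NormedAddCommGroup W] [NormedSpace ℝ W] [NormedAddCommGroup E]
    [NormedSpace ℝ E] (j : W → E) (S T : E → ℝ) (α b : ℝ) (h : ∀ y, T y ≤ S y + b)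
    (hS : Lev j S α) : Lev j T (α + b) := by
  obtain ⟨f, h1, h2, h3⟩ := hS
  exact ⟨f, h1, h2, fun x => (h _).trans (by linarith [h3 x])⟩

/-- The linking statement: the hyperbolic form cannot be pushed below a negative level. -/
lemma lev_hyperbolic {W : Type*} [NormedAddCommGroup W] [InnerProductSpace ℝ W]
    [FiniteDimensional ℝ W] (α : ℝ)
    (h : Lev (fun x : W => (WithLp.toLp 2 (x, -x) : WithLp 2 (W × W)))
      (fun y => inner ℝ y.fst y.snd) α) : 0 ≤ α := by
  obtain ⟨f, hf, ⟨B, hB⟩, hα⟩ := h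
  have key : ∃ x, (1 / 2 : ℝ) • ((f x).fst - (f x).snd) = 0 := by
    refine br_hit (fun x => (1 / 2 : ℝ) • ((f x).fst - (f x).snd)) ?_ B ?_
    · have hfst : ContDiff ℝ 1 (fun x => (f x).fst) :=
        (WithLp.fstL 2 ℝ W W).contDiff.comp hf
      have hsnd : ContDiff ℝ 1 (fun x => (f x).snd) :=
        (WithLp.sndL 2 ℝ W W).contDiff.comp hf
      exact (hfst.sub hsnd).const_smul _
    · intro x
      have h1 := hB x
      set e := f x - WithLp.toLp 2 (x, -x) with he
      have h2 : (1 / 2 : ℝ) • ((f x).fst - (f x).snd) - x = (1 / 2 : ℝ) • (e.fst - e.snd) := by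
        have e1 : e.fst = (f x).fst - x := rfl
        have e2 : e.snd = (f x).snd - -x := rfl
        rw [e1, e2]
        module
      rw [h2, norm_smul]
      have h3 : ‖e.fst‖ ≤ ‖e‖ := WithLp.norm_fst_le _ _
      have h4 : ‖e.snd‖ ≤ ‖e‖ := WithLp.norm_snd_le _ _
      have h5 := norm_sub_le e.fst e.snd
      rw [Real.norm_of_nonneg (by norm_num)]
      linarith
  obtain ⟨x, hx⟩ := key
  have h1 : (f x).fst = (f x).snd := by
    have := smul_eq_zero.1 hx
    rcases this with h | h
    · norm_num at h
    · exact sub_eq_zero.1 h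
  have h2 : inner ℝ (f x).fst (f x).snd ≤ α := hα x
  rw [h1] at h2
  exact le_trans real_inner_self_nonneg h2

/-- Uniform `C²` bounds. -/
def Bd {n : ℕ} (Λ : ℝ) (F : Phase n → ℝ) : Prop :=
  ContDiff ℝ 2 F ∧ (∀ x, ‖fderiv ℝ F x‖ ≤ Λ) ∧
    (∀ x y, ‖fderiv ℝ F x - fderiv ℝ F y‖ ≤ Λ * ‖x - y‖) ∧ ∀ x, |F x| ≤ Λ

lemma Bd.nonneg {n : ℕ} {Λ : ℝ} {F : Phase n → ℝ} (h : Bd Λ F) : 0 ≤ Λ :=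
  (norm_nonneg _).trans (h.2.1 0)

lemma Bd.mono {n : ℕ} {Λ Λ' : ℝ} {F : Phase n → ℝ} (h : Bd Λ F) (hΛ : Λ ≤ Λ') : Bd Λ' F :=
  ⟨h.1, fun x => (h.2.1 x).trans hΛ, fun x y => (h.2.2.1 x y).trans
    (mul_le_mul_of_nonneg_right hΛ (norm_nonneg _)), fun x => (h.2.2.2 x).trans hΛ⟩

lemma Bd.neg {n : ℕ} {Λ : ℝ} {F : Phase n → ℝ} (h : Bd Λ F) : Bd Λ (fun x => - F x) := by
  refine ⟨h.1.neg, fun x => ?_, fun x y => ?_, fun x => ?_⟩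
  · rw [fderiv_fun_neg, norm_neg]; exact h.2.1 x
  · rw [fderiv_fun_neg, fderiv_fun_neg, ← neg_sub', norm_neg]; exact h.2.2.1 x y
  · rw [abs_neg]; exact h.2.2.2 x

lemma exists_Bd {n : ℕ} {F : Phase n → ℝ} (hF : SmoothCpt F) : ∃ Λ, Bd Λ F := by
  obtain ⟨h1, h2⟩ := hF
  have hF2 : ContDiff ℝ 2 F := h1.of_le (by exact WithTop.coe_le_coe.mpr le_top)
  have hd : ContDiff ℝ 1 (fderiv ℝ F) := hF2.fderiv_right (by norm_num)
  have hdc : HasCompactSupport (fderiv ℝ F) := h2.fderiv ℝ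
  obtain ⟨A, hA⟩ := h2.exists_bound_of_continuous h1.continuous
  obtain ⟨B, hB⟩ := hdc.exists_bound_of_continuous hd.continuous
  obtain ⟨C, hC⟩ := hd.lipschitzWith_of_hasCompactSupport hdc one_ne_zero
  refine ⟨max (max A B) C, hF2, fun x => (hB x).trans ?_, fun x y => ?_, fun x => (hA x).trans ?_⟩
  · exact (le_max_right _ _).trans (le_max_left _ _)
  · have := hC.dist_le_mul x y
    rw [dist_eq_norm, dist_eq_norm] at this
    exact this.trans (mul_le_mul_of_nonneg_right (le_max_right _ _) (norm_nonneg _))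
  · exact (le_max_left _ _).trans (le_max_left _ _)

lemma norm_vP {n : ℕ} (i : Fin n) : ‖((Pi.single i 1, 0) : Phase n)‖ ≤ 1 := by
  rw [Prod.norm_def, norm_zero]
  refine max_le ?_ ?_ <;> try exact zero_le_one
  rw [pi_norm_le_iff_of_nonneg zero_le_one]
  intro j
  dsimp only
  rw [Pi.single_apply]
  split_ifs <;> simp

lemma norm_vQ {n : ℕ} (i : Fin n) : ‖((0, Pi.single i 1) : Phase n)‖ ≤ 1 := by
  rw [Prod.norm_def, norm_zero]
  refine max_le ?_ ?_ <;> try exact zero_le_one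
  rw [pi_norm_le_iff_of_nonneg zero_le_one]
  intro j
  dsimp only
  rw [Pi.single_apply]
  split_ifs <;> simp

/-- The Hamiltonian velocity with the two components evaluated separately. -/
noncomputable def hv {n : ℕ} (K H : Phase n → ℝ) (w' w : Phase n) : Phase n :=
  (fun i => - pderivQ K i w', fun i => pderivP H i w)

lemma poisson_eq {n : ℕ} (φ H : Phase n → ℝ) (w : Phase n) :
    poisson φ H w = fderiv ℝ φ w (hv H H w w) := by
  have h : hv H H w w = ∑ i, (pderivP H i w • ((0, Pi.single i 1) : Phase n)
      - pderivQ H i w • ((Pi.single i 1, 0) : Phase n)) := by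
    have key : ∀ a : Fin n → ℝ, ∑ i, a i • (Pi.single i (1 : ℝ) : Fin n → ℝ) = a := by
      intro a
      ext j
      simp [Finset.sum_apply, Pi.single_apply]
    refine Prod.ext ?_ ?_
    · rw [Prod.fst_sum]
      simp only [hv, Prod.fst_sub, Prod.smul_fst, smul_zero, zero_sub]
      rw [Finset.sum_neg_distrib, key]
      rfl
    · rw [Prod.snd_sum]
      simp only [hv, Prod.snd_sub, Prod.smul_snd, smul_zero, sub_zero]
      rw [key]
  rw [h, map_sum]
  unfold poisson
  refine Finset.sum_congr rfl fun i _ => ?_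
  rw [map_sub, map_smul, map_smul, smul_eq_mul, smul_eq_mul]
  simp only [pderivP, pderivQ]
  ring

lemma poisson_self {n : ℕ} (φ : Phase n → ℝ) (w : Phase n) : poisson φ φ w = 0 := by
  unfold poisson
  exact Finset.sum_eq_zero fun i _ => by ring

lemma poisson_swap {n : ℕ} (φ H : Phase n → ℝ) (w : Phase n) :
    poisson H φ w = - poisson φ H w := by
  unfold poisson
  rw [← Finset.sum_neg_distrib]
  exact Finset.sum_congr rfl fun i _ => by ring

lemma poisson_neg_right {n : ℕ} (φ H : Phase n → ℝ) (w : Phase n) :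
    poisson φ (fun x => - H x) w = - poisson φ H w := by
  unfold poisson pderivP pderivQ
  rw [← Finset.sum_neg_distrib]
  refine Finset.sum_congr rfl fun i _ => ?_
  rw [fderiv_fun_neg]
  simp only [neg_apply]
  ring

lemma hv_norm {n : ℕ} {Λ : ℝ} {K H : Phase n → ℝ} (hK : Bd Λ K) (hH : Bd Λ H) (w' w : Phase n) :
    ‖hv K H w' w‖ ≤ Λ := by
  have h0 := hK.nonneg
  rw [Prod.norm_def]
  refine max_le ?_ ?_ <;> rw [pi_norm_le_iff_of_nonneg h0] <;> intro i
  · simp only [hv, norm_neg, pderivQ]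
    refine (ContinuousLinearMap.le_opNorm _ _).trans ?_
    exact (mul_le_of_le_one_right (norm_nonneg _) (norm_vQ i)).trans (hK.2.1 _)
  · simp only [hv, pderivP]
    refine (ContinuousLinearMap.le_opNorm _ _).trans ?_
    exact (mul_le_of_le_one_right (norm_nonneg _) (norm_vP i)).trans (hH.2.1 _)

lemma hv_lip {n : ℕ} {Λ : ℝ} {H : Phase n → ℝ} (hH : Bd Λ H) (w' w : Phase n) :
    ‖hv H H w' w - hv H H w w‖ ≤ Λ * ‖w' - w‖ := by
  have h0 := hH.nonneg
  have h1 : 0 ≤ Λ * ‖w' - w‖ := by positivity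
  rw [Prod.norm_def]
  refine max_le ?_ ?_ <;> rw [pi_norm_le_iff_of_nonneg h1] <;> intro i
  · have : (hv H H w' w - hv H H w w).1 i
        = - ((fderiv ℝ H w' - fderiv ℝ H w) (0, Pi.single i 1)) := by
      simp [hv, pderivQ]; ring
    rw [this, norm_neg]
    refine (ContinuousLinearMap.le_opNorm _ _).trans ?_
    exact (mul_le_of_le_one_right (norm_nonneg _) (norm_vQ i)).trans (hH.2.2.1 _ _)
  · have : (hv H H w' w - hv H H w w).2 i = 0 := by simp [hv]
    rw [this, norm_zero]; exact h1

lemma step_norm {n : ℕ} {Λ τ h ν : ℝ} {K H : Phase n → ℝ} (hK : Bd Λ K) (hH : Bd Λ H)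
    (hτ0 : 0 ≤ τ) (hν : 2 * ν ≤ 2 * h)
    (hτ : τ ≤ h) {w' w : Phase n} (hw : ‖w' - w - τ • hv K H w' w‖ ≤ 2 * ν) :
    ‖w' - w‖ ≤ (Λ + 2) * h := by
  have h1 : ‖w' - w‖ ≤ ‖w' - w - τ • hv K H w' w‖ + ‖τ • hv K H w' w‖ := by
    have := norm_add_le (w' - w - τ • hv K H w' w) (τ • hv K H w' w)
    rwa [sub_add_cancel] at this
  rw [norm_smul, Real.norm_of_nonneg hτ0] at h1
  have h2 : τ * ‖hv K H w' w‖ ≤ h * Λ :=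
    mul_le_mul hτ (hv_norm hK hH _ _) (norm_nonneg _) (hτ0.trans hτ)
  linarith

lemma step_any {n : ℕ} {Λ : ℝ} {φ : Phase n → ℝ} (hφ : Bd Λ φ) (w' w : Phase n) :
    |φ w' - φ w| ≤ Λ * ‖w' - w‖ := by
  exact convex_univ.norm_image_sub_le_of_norm_fderiv_le (𝕜 := ℝ)
    (fun x _ => hφ.1.differentiable two_ne_zero x) (fun x _ => hφ.2.1 x)
    (Set.mem_univ w) (Set.mem_univ w')

lemma step_taylor {n : ℕ} {Λ : ℝ} {φ : Phase n → ℝ} (hφ : Bd Λ φ) (w' w : Phase n) :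
    |φ w' - φ w - fderiv ℝ φ w (w' - w)| ≤ (Λ * ‖w' - w‖) * ‖w' - w‖ := by
  refine (convex_segment w w').norm_image_sub_le_of_norm_fderiv_le' (𝕜 := ℝ)
    (fun x _ => hφ.1.differentiable two_ne_zero x) ?_ (left_mem_segment ℝ w w')
    (right_mem_segment ℝ w w')
  intro x hx
  have hx' : ‖x - w‖ ≤ ‖w' - w‖ := by
    obtain ⟨t, ht, rfl⟩ := (segment_eq_image' ℝ w w' ▸ hx)
    rw [add_sub_cancel_left, norm_smul, Real.norm_of_nonneg ht.1]
    exact mul_le_of_le_one_left (norm_nonneg _) ht.2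
  exact (hφ.2.2.1 x w).trans (mul_le_mul_of_nonneg_left hx' hφ.nonneg)

lemma step_same {n : ℕ} {Λ τ h : ℝ} {φ H : Phase n → ℝ} (hφ : Bd Λ φ) (hH : Bd Λ H)
    (hτ0 : 0 ≤ τ) (hτ : τ ≤ h) (hh : h ≤ 1) {w' w : Phase n}
    (hw : ‖w' - w - τ • hv H H w' w‖ ≤ 2 * h ^ 2) :
    |φ w' - φ w - τ * poisson φ H w| ≤ 3 * (Λ + 2) ^ 3 * h ^ 2 := by
  have hΛ := hφ.nonneg
  have hh0 : 0 ≤ h := hτ0.trans hτ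
  have hn : ‖w' - w‖ ≤ (Λ + 2) * h := step_norm (ν := h ^ 2) hH hH hτ0 (by nlinarith) hτ hw
  have h1 := step_taylor hφ w' w
  have h2 : |φ w' - φ w - fderiv ℝ φ w (w' - w)| ≤ Λ * ((Λ + 2) * h) * ((Λ + 2) * h) := by
    refine h1.trans ?_
    gcongr
  have h3 : fderiv ℝ φ w (w' - w) - τ * poisson φ H w
      = fderiv ℝ φ w (w' - w - τ • hv H H w' w)
        + τ * fderiv ℝ φ w (hv H H w' w - hv H H w w) := by
    rw [poisson_eq, map_sub (fderiv ℝ φ w) (w' - w), map_sub (fderiv ℝ φ w) (hv H H w' w),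
      map_smul, smul_eq_mul]
    ring
  have h4 : |fderiv ℝ φ w (w' - w - τ • hv H H w' w)| ≤ Λ * (2 * h ^ 2) := by
    rw [← Real.norm_eq_abs]
    refine (ContinuousLinearMap.le_opNorm _ _).trans ?_
    exact mul_le_mul (hφ.2.1 _) hw (norm_nonneg _) hΛ
  have h5 : |τ * fderiv ℝ φ w (hv H H w' w - hv H H w w)| ≤ h * (Λ * (Λ * ((Λ + 2) * h))) := by
    rw [abs_mul, abs_of_nonneg hτ0]
    refine mul_le_mul hτ ?_ (abs_nonneg _) hh0
    rw [← Real.norm_eq_abs]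
    refine (ContinuousLinearMap.le_opNorm _ _).trans ?_
    refine mul_le_mul (hφ.2.1 _) ?_ (norm_nonneg _) hΛ
    exact (hv_lip hH w' w).trans (mul_le_mul_of_nonneg_left hn hΛ)
  have h6 : φ w' - φ w - τ * poisson φ H w = (φ w' - φ w - fderiv ℝ φ w (w' - w))
      + (fderiv ℝ φ w (w' - w - τ • hv H H w' w)
        + τ * fderiv ℝ φ w (hv H H w' w - hv H H w w)) := by
    rw [← h3]; ring
  rw [h6]
  refine (abs_add_le _ _).trans ((add_le_add h2 ((abs_add_le _ _).trans (add_le_add h4 h5))).trans ?_)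
  have h7 : Λ * (Λ + 2) ^ 2 + 2 * Λ + Λ ^ 2 * (Λ + 2) ≤ 3 * (Λ + 2) ^ 3 := by
    nlinarith [pow_nonneg hΛ 2, pow_nonneg hΛ 3]
  have h8 : 0 ≤ h ^ 2 := sq_nonneg _
  nlinarith [mul_le_mul_of_nonneg_right h7 h8]

lemma avg_close (N : ℕ) (h e r : ℝ) (hN : (N : ℝ) * h = 1) (hh : 0 ≤ h) (f : ℕ → ℝ)
    (hf : ∀ i < N, |f i - r| ≤ e) : |h * ∑ i ∈ Finset.range N, f i - r| ≤ e := by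
  have h1 : h * ∑ i ∈ Finset.range N, f i - r = h * ∑ i ∈ Finset.range N, (f i - r) := by
    rw [Finset.sum_sub_distrib, Finset.sum_const, Finset.card_range, nsmul_eq_mul, mul_sub]
    linear_combination -r * (-hN)
  rw [h1, abs_mul, abs_of_nonneg hh]
  have h2 : |∑ i ∈ Finset.range N, (f i - r)| ≤ N * e := by
    refine (Finset.abs_sum_le_sum_abs _ _).trans ?_
    refine (Finset.sum_le_sum (g := fun _ => e) fun i hi => hf i (Finset.mem_range.1 hi)).trans ?_
    rw [Finset.sum_const, Finset.card_range, nsmul_eq_mul]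
  calc h * |∑ i ∈ Finset.range N, (f i - r)| ≤ h * (N * e) := by gcongr
    _ = e := by linear_combination e * hN

lemma seg_sum {n : ℕ} {Λ τ h : ℝ} {φ H : Phase n → ℝ} (hφ : Bd Λ φ) (hH : Bd Λ H)
    (hτ0 : 0 ≤ τ) (hτ : τ ≤ h) (hh : h ≤ 1) (w : ℕ → Phase n) (a M : ℕ)
    (hw : ∀ i < M, ‖w (a + i + 1) - w (a + i) - τ • hv H H (w (a + i + 1)) (w (a + i))‖
      ≤ 2 * h ^ 2) :
    |φ (w (a + M)) - φ (w a) - τ * ∑ i ∈ Finset.range M, poisson φ H (w (a + i))|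
      ≤ M * (3 * (Λ + 2) ^ 3 * h ^ 2) := by
  induction M with
  | zero => simp
  | succ M ih =>
    have h1 := ih fun i hi => hw i (by omega)
    have h2 := step_same hφ hH hτ0 hτ hh (hw M (by omega))
    rw [Finset.sum_range_succ, ← add_assoc]
    push_cast
    have h3 : φ (w (a + M + 1)) - φ (w a)
        - τ * (∑ i ∈ Finset.range M, poisson φ H (w (a + i)) + poisson φ H (w (a + M)))
        = (φ (w (a + M)) - φ (w a) - τ * ∑ i ∈ Finset.range M, poisson φ H (w (a + i)))
          + (φ (w (a + M + 1)) - φ (w (a + M)) - τ * poisson φ H (w (a + M))) := by ring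
    rw [h3]
    refine (abs_add_le _ _).trans ((add_le_add h1 h2).trans (le_of_eq ?_))
    ring

lemma seg_const {n : ℕ} {Λ τ h : ℝ} {H : Phase n → ℝ} (hH : Bd Λ H)
    (hτ0 : 0 ≤ τ) (hτ : τ ≤ h) (hh : h ≤ 1) (w : ℕ → Phase n) (a M : ℕ)
    (hM : (M : ℝ) * h ≤ 1)
    (hw : ∀ i < M, ‖w (a + i + 1) - w (a + i) - τ • hv H H (w (a + i + 1)) (w (a + i))‖
      ≤ 2 * h ^ 2) (i : ℕ) (hi : i ≤ M) :
    |H (w (a + i)) - H (w a)| ≤ 3 * (Λ + 2) ^ 3 * h := by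
  have h1 := seg_sum hH hH hτ0 hτ hh w a i fun k hk => hw k (by omega)
  simp only [poisson_self, Finset.sum_const_zero, mul_zero, sub_zero] at h1
  refine h1.trans ?_
  have h2 : (i : ℝ) * h ≤ 1 :=
    (mul_le_mul_of_nonneg_right (by exact_mod_cast hi) (hτ0.trans hτ)).trans hM
  have h3 := hH.nonneg
  have h4 := hτ0.trans hτ
  have h5 : 0 ≤ 3 * (Λ + 2) ^ 3 * h := by positivity
  nlinarith

/-- The four-piece time dependent Hamiltonian `F, G, -F, -G`. -/
noncomputable def Hs {n : ℕ} (F G : Phase n → ℝ) (N k : ℕ) : Phase n → ℝ :=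
  if k < N then F else if k < 2 * N then G else if k < 3 * N then (fun x => - F x)
    else (fun x => - G x)

lemma Hs_Bd {n : ℕ} {Λ : ℝ} {F G : Phase n → ℝ} (hF : Bd Λ F) (hG : Bd Λ G) (N k : ℕ) :
    Bd Λ (Hs F G N k) := by
  unfold Hs
  split_ifs
  exacts [hF, hG, hF.neg, hG.neg]

lemma seg_action {n : ℕ} {Λ τ h : ℝ} {F G : Phase n → ℝ} (hF : Bd Λ F) (hG : Bd Λ G)
    (hτ0 : 0 ≤ τ) (hτ : τ ≤ h) (hh : h ≤ 1) (N M : ℕ) (hNM : N = M + 1) (hN : (N : ℝ) * h = 1)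
    (w : ℕ → Phase n)
    (hw : ∀ k, k + 1 < 4 * N → ‖w (k + 1) - w k - τ • hv (Hs F G N (k + 1)) (Hs F G N k)
      (w (k + 1)) (w k)‖ ≤ 2 * h ^ 2) :
    |-(h * ∑ k ∈ Finset.range (4 * N), Hs F G N k (w k))
      - τ * ∑ i ∈ Finset.range M, (poisson F G (w (N + i)) + poisson F G (w (2 * N + i)))|
      ≤ 42 * (Λ + 2) ^ 3 * h := by
  have hΛ := hF.nonneg
  have hh0 : 0 ≤ h := hτ0.trans hτ
  have hMh : (M : ℝ) * h ≤ 1 := by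
    have : (N : ℝ) = M + 1 := by exact_mod_cast hNM
    nlinarith
  have e0 : ∀ k, k < N → Hs F G N k = F := fun k hk => by simp [Hs, hk]
  have e1 : ∀ k, N ≤ k → k < 2 * N → Hs F G N k = G := fun k h1 h2 => by
    simp [Hs, h2, not_lt.2 h1]
  have e2 : ∀ k, 2 * N ≤ k → k < 3 * N → Hs F G N k = fun x => - F x := fun k h1 h2 => by
    simp [Hs, h2, not_lt.2 h1, show ¬ k < N by omega]
  have e3 : ∀ k, 3 * N ≤ k → Hs F G N k = fun x => - G x := fun k h1 => by
    simp [Hs, not_lt.2 h1, show ¬ k < N by omega, show ¬ k < 2 * N by omega]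
  have w0 : ∀ i < M, ‖w (0 + i + 1) - w (0 + i) - τ • hv F F (w (0 + i + 1)) (w (0 + i))‖
      ≤ 2 * h ^ 2 := fun i hi => by
    have := hw (0 + i) (by omega)
    rwa [e0 _ (by omega), e0 _ (by omega)] at this
  have w1 : ∀ i < M, ‖w (N + i + 1) - w (N + i) - τ • hv G G (w (N + i + 1)) (w (N + i))‖
      ≤ 2 * h ^ 2 := fun i hi => by
    have := hw (N + i) (by omega)
    rwa [e1 _ (by omega) (by omega), e1 _ (by omega) (by omega)] at this
  have w2 : ∀ i < M, ‖w (2 * N + i + 1) - w (2 * N + i) - τ • hv (fun x => - F x) (fun x => - F x)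
      (w (2 * N + i + 1)) (w (2 * N + i))‖ ≤ 2 * h ^ 2 := fun i hi => by
    have := hw (2 * N + i) (by omega)
    rwa [e2 _ (by omega) (by omega), e2 _ (by omega) (by omega)] at this
  have w3 : ∀ i < M, ‖w (3 * N + i + 1) - w (3 * N + i) - τ • hv (fun x => - G x) (fun x => - G x)
      (w (3 * N + i + 1)) (w (3 * N + i))‖ ≤ 2 * h ^ 2 := fun i hi => by
    have := hw (3 * N + i) (by omega)
    rwa [e3 _ (by omega), e3 _ (by omega)] at this
  have cross : ∀ φ : Phase n → ℝ, Bd Λ φ → ∀ k, k + 1 < 4 * N →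
      |φ (w (k + 1)) - φ (w k)| ≤ 3 * (Λ + 2) ^ 3 * h := by
    intro φ hφ k hk
    refine (step_any hφ _ _).trans ?_
    have h1 : ‖w (k + 1) - w k‖ ≤ (Λ + 2) * h :=
      step_norm (ν := h ^ 2) (Hs_Bd hF hG N (k + 1)) (Hs_Bd hF hG N k) hτ0 (by nlinarith) hτ
        (hw k hk)
    calc Λ * ‖w (k + 1) - w k‖ ≤ Λ * ((Λ + 2) * h) := by gcongr
      _ ≤ 3 * (Λ + 2) ^ 3 * h := by
        have : Λ * (Λ + 2) ≤ 3 * (Λ + 2) ^ 3 := by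
          nlinarith [pow_nonneg hΛ 2, pow_nonneg hΛ 3]
        nlinarith
  set c := 3 * (Λ + 2) ^ 3 * h with hc
  -- averages
  have a0 : |h * ∑ i ∈ Finset.range N, F (w (0 + i)) - F (w (0 + M))| ≤ 2 * c := by
    refine avg_close N h _ _ hN hh0 (fun i => F (w (0 + i))) fun i hi => ?_
    have h1 := seg_const hF hτ0 hτ hh w 0 M hMh w0 i (by omega)
    have h2 := seg_const hF hτ0 hτ hh w 0 M hMh w0 M le_rfl
    rw [← hc, abs_le] at h1 h2
    rw [abs_le]
    constructor <;> linarith [h1.1, h1.2, h2.1, h2.2]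
  have a1 : |h * ∑ i ∈ Finset.range N, G (w (N + i)) - G (w (N + M))| ≤ 2 * c := by
    refine avg_close N h _ _ hN hh0 (fun i => G (w (N + i))) fun i hi => ?_
    have h1 := seg_const hG hτ0 hτ hh w N M hMh w1 i (by omega)
    have h2 := seg_const hG hτ0 hτ hh w N M hMh w1 M le_rfl
    rw [← hc, abs_le] at h1 h2
    rw [abs_le]
    constructor <;> linarith [h1.1, h1.2, h2.1, h2.2]
  have a2 : |h * ∑ i ∈ Finset.range N, - F (w (2 * N + i)) - (- F (w (2 * N)))| ≤ c :=
    avg_close N h _ _ hN hh0 (fun i => - F (w (2 * N + i))) fun i hi =>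
      seg_const hF.neg hτ0 hτ hh w (2 * N) M hMh w2 i (by omega)
  have a3 : |h * ∑ i ∈ Finset.range N, - G (w (3 * N + i)) - (- G (w (3 * N)))| ≤ c :=
    avg_close N h _ _ hN hh0 (fun i => - G (w (3 * N + i))) fun i hi =>
      seg_const hG.neg hτ0 hτ hh w (3 * N) M hMh w3 i (by omega)
  have hMc : (M : ℝ) * (3 * (Λ + 2) ^ 3 * h ^ 2) ≤ c := by
    have : 0 ≤ c := by positivity
    calc (M : ℝ) * (3 * (Λ + 2) ^ 3 * h ^ 2) = (M * h) * c := by rw [hc]; ring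
      _ ≤ 1 * c := by gcongr
      _ = c := one_mul c
  have b1 := (seg_sum hF hG hτ0 hτ hh w N M w1).trans hMc
  have b2 := (seg_sum hG hF.neg hτ0 hτ hh w (2 * N) M w2).trans hMc
  have b2' : ∑ i ∈ Finset.range M, poisson G (fun x => - F x) (w (2 * N + i))
      = ∑ i ∈ Finset.range M, poisson F G (w (2 * N + i)) :=
    Finset.sum_congr rfl fun i _ => by rw [poisson_neg_right, poisson_swap, neg_neg]
  rw [b2'] at b2
  have c1 := cross F hF (0 + M) (by omega)
  have c2 := cross F hF (N + M) (by omega)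
  have c3 := cross G hG (N + M) (by omega)
  have c4 := cross G hG (2 * N + M) (by omega)
  rw [show 0 + M + 1 = N by omega] at c1
  rw [show N + M + 1 = 2 * N by omega] at c2 c3
  rw [show 2 * N + M + 1 = 3 * N by omega] at c4
  have hsum : ∑ k ∈ Finset.range (4 * N), Hs F G N k (w k)
      = ∑ i ∈ Finset.range N, F (w (0 + i)) + ∑ i ∈ Finset.range N, G (w (N + i))
        + ∑ i ∈ Finset.range N, - F (w (2 * N + i)) + ∑ i ∈ Finset.range N, - G (w (3 * N + i)) := by
    rw [show 4 * N = 3 * N + N by ring, Finset.sum_range_add, show 3 * N = 2 * N + N by ring,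
      Finset.sum_range_add, show 2 * N = N + N by ring, Finset.sum_range_add]
    congr 1
    · congr 1
      · congr 1
        · refine Finset.sum_congr rfl fun i hi => ?_
          have := Finset.mem_range.1 hi
          rw [e0 _ (by omega), zero_add]
        · refine Finset.sum_congr rfl fun i hi => ?_
          have := Finset.mem_range.1 hi
          rw [e1 _ (by omega) (by omega)]
      · refine Finset.sum_congr rfl fun i hi => ?_
        have := Finset.mem_range.1 hi
        rw [e2 _ (by omega) (by omega)]
    · refine Finset.sum_congr rfl fun i hi => ?_
      have := Finset.mem_range.1 hi
      rw [e3 _ (by omega)]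
  rw [hsum, Finset.sum_add_distrib, mul_add, mul_add, mul_add, mul_add,
    show 42 * (Λ + 2) ^ 3 * h = 14 * c by rw [hc]; ring]
  rw [abs_le] at a0 a1 a2 a3 b1 b2 c1 c2 c3 c4
  rw [abs_le]
  constructor <;>
  linarith [a0.1, a0.2, a1.1, a1.2, a2.1, a2.2, a3.1, a3.2, b1.1, b1.2, b2.1, b2.2, c1.1, c1.2,
    c2.1, c2.2, c3.1, c3.2, c4.1, c4.2]

lemma csm2 {W : Type*} [NormedAddCommGroup W] [InnerProductSpace ℝ W] :
    ContinuousSMul ℝ (WithLp 2 (W × W)) := inferInstance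

/-- Configuration space of one family of variables. -/
abbrev WW (m n : ℕ) := EuclideanSpace ℝ (Fin m × Fin n)

/-- Space of discrete paths. -/
abbrev EE (m n : ℕ) := WithLp 2 (WW m n × WW m n)

instance EE_csm (m n : ℕ) : ContinuousSMul ℝ (EE m n) := csm2

/-- Position of the discrete path at time `k`, relative to the base point. -/
noncomputable def ell {m n : ℕ} (k : ℕ) : EE m n →L[ℝ] Phase n :=
  LinearMap.toContinuousLinearMap
    { toFun := fun Y => (fun i => if hk : k < m then Y.fst (⟨k, hk⟩, i) else 0,
        fun i => ∑ l : Fin m, if (l : ℕ) < k then Y.snd (l, i) else 0)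
      map_add' := fun Y Z => by
        refine Prod.ext (funext fun i => ?_) (funext fun i => ?_)
        · by_cases hk : k < m <;> simp [hk]
        · simp only [WithLp.add_snd, PiLp.add_apply, Prod.snd_add, Pi.add_apply]
          rw [← Finset.sum_add_distrib]
          refine Finset.sum_congr rfl fun l _ => ?_
          split_ifs <;> simp
      map_smul' := fun c Y => by
        refine Prod.ext (funext fun i => ?_) (funext fun i => ?_)
        · by_cases hk : k < m <;> simp [hk]
        · simp only [WithLp.smul_snd, PiLp.smul_apply, Prod.smul_snd, Pi.smul_apply,
            RingHom.id_apply, smul_eq_mul, Finset.mul_sum]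
          refine Finset.sum_congr rfl fun l _ => ?_
          split_ifs <;> simp }

lemma ell_fst {m n : ℕ} (k : ℕ) (Y : EE m n) (i : Fin n) :
    (ell k Y).1 i = if hk : k < m then Y.fst (⟨k, hk⟩, i) else 0 := rfl

lemma ell_snd {m n : ℕ} (k : ℕ) (Y : EE m n) (i : Fin n) :
    (ell k Y).2 i = ∑ l : Fin m, if (l : ℕ) < k then Y.snd (l, i) else 0 := rfl

/-- The hyperbolic part of the action. -/
noncomputable def Qf {m n : ℕ} (Y : EE m n) : ℝ := inner ℝ Y.fst Y.snd

/-- The Hamiltonian part of the action. -/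
noncomputable def Rf {m n : ℕ} (H : ℕ → Phase n → ℝ) (h : ℝ) (x0 : Phase n) (Y : EE m n) : ℝ :=
  -(h * ∑ k ∈ Finset.range (m + 1), H k (x0 + ell k Y))

/-- Derivative of `Rf`. -/
noncomputable def dRf {m n : ℕ} (H : ℕ → Phase n → ℝ) (h : ℝ) (x0 : Phase n) (Y : EE m n) :
    EE m n →L[ℝ] ℝ :=
  -(h • ∑ k ∈ Finset.range (m + 1), (fderiv ℝ (H k) (x0 + ell k Y)).comp (ell k))

lemma Qf_contDiff {m n : ℕ} : ContDiff ℝ 2 (Qf : EE m n → ℝ) :=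
  ContDiff.inner ℝ (WithLp.fstL 2 ℝ (WW m n) (WW m n)).contDiff
    (WithLp.sndL 2 ℝ (WW m n) (WW m n)).contDiff

lemma Qf_fderiv {m n : ℕ} (Y v : EE m n) :
    fderiv ℝ (Qf : EE m n → ℝ) Y v = inner ℝ Y.fst v.snd + inner ℝ v.fst Y.snd := by
  have h1 := ((WithLp.fstL 2 ℝ (WW m n) (WW m n)).hasFDerivAt (x := Y)).inner ℝ
    ((WithLp.sndL 2 ℝ (WW m n) (WW m n)).hasFDerivAt (x := Y))
  have h2 : HasFDerivAt (Qf : EE m n → ℝ) _ Y := h1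
  rw [h2.fderiv]
  rfl

lemma Qf_lip {m n : ℕ} (X Y : EE m n) :
    ‖fderiv ℝ (Qf : EE m n → ℝ) X - fderiv ℝ Qf Y‖ ≤ 2 * ‖X - Y‖ := by
  refine ContinuousLinearMap.opNorm_le_bound _ (by positivity) fun v => ?_
  have h1 : (fderiv ℝ (Qf : EE m n → ℝ) X - fderiv ℝ Qf Y) v
      = inner ℝ (X - Y).fst v.snd + inner ℝ v.fst (X - Y).snd := by
    rw [sub_apply, Qf_fderiv, Qf_fderiv, WithLp.sub_fst, WithLp.sub_snd,
      inner_sub_left, inner_sub_right]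
    ring
  rw [h1]
  refine (norm_add_le _ _).trans ?_
  have h2 := norm_inner_le_norm (𝕜 := ℝ) (X - Y).fst v.snd
  have h3 := norm_inner_le_norm (𝕜 := ℝ) v.fst (X - Y).snd
  have a1 : ‖(X - Y).fst‖ ≤ ‖X - Y‖ := WithLp.norm_fst_le _ _
  have a2 : ‖(X - Y).snd‖ ≤ ‖X - Y‖ := WithLp.norm_snd_le _ _
  have a3 : ‖v.fst‖ ≤ ‖v‖ := WithLp.norm_fst_le _ _
  have a4 : ‖v.snd‖ ≤ ‖v‖ := WithLp.norm_snd_le _ _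
  have b1 := mul_le_mul a1 a4 (norm_nonneg _) (norm_nonneg _)
  have b2 := mul_le_mul a3 a2 (norm_nonneg _) (norm_nonneg _)
  linarith

lemma Rf_contDiff {m n : ℕ} {Λ : ℝ} {H : ℕ → Phase n → ℝ} (hH : ∀ k, Bd Λ (H k)) (h : ℝ)
    (x0 : Phase n) : ContDiff ℝ 2 (Rf H h x0 : EE m n → ℝ) := by
  refine (contDiff_const.mul (ContDiff.sum fun k _ => ?_)).neg
  exact (hH k).1.comp (contDiff_const.add (ell k).contDiff)

lemma Rf_hasFDerivAt {m n : ℕ} {Λ : ℝ} {H : ℕ → Phase n → ℝ} (hH : ∀ k, Bd Λ (H k)) (h : ℝ)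
    (x0 : Phase n) (Y : EE m n) : HasFDerivAt (Rf H h x0) (dRf H h x0 Y) Y := by
  refine HasFDerivAt.fun_neg (HasFDerivAt.const_mul (HasFDerivAt.fun_sum fun k _ => ?_) h)
  have h1 : HasFDerivAt (H k) (fderiv ℝ (H k) (x0 + ell k Y)) (x0 + ell k Y) :=
    ((hH k).1.differentiable two_ne_zero _).hasFDerivAt
  exact h1.comp Y ((ell k).hasFDerivAt.const_add x0)

lemma Rf_lip {m n : ℕ} {Λ : ℝ} {H : ℕ → Phase n → ℝ} (hH : ∀ k, Bd Λ (H k)) (h : ℝ)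
    (x0 : Phase n) : ∃ L, 0 ≤ L ∧ ∀ X Y : EE m n,
      ‖fderiv ℝ (Rf H h x0) X - fderiv ℝ (Rf H h x0) Y‖ ≤ L * ‖X - Y‖ := by
  have hΛ := (hH 0).nonneg
  refine ⟨|h| * ∑ k ∈ Finset.range (m + 1), Λ * ‖(ell k : EE m n →L[ℝ] Phase n)‖ ^ 2,
    by positivity, fun X Y => ?_⟩
  rw [(Rf_hasFDerivAt hH h x0 X).fderiv, (Rf_hasFDerivAt hH h x0 Y).fderiv]
  unfold dRf
  rw [← neg_sub', norm_neg, ← smul_sub, ← Finset.sum_sub_distrib, norm_smul, Real.norm_eq_abs,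
    mul_assoc, Finset.sum_mul]
  refine mul_le_mul_of_nonneg_left ((norm_sum_le _ _).trans (Finset.sum_le_sum fun k _ => ?_))
    (abs_nonneg h)
  rw [← ContinuousLinearMap.sub_comp]
  refine (ContinuousLinearMap.opNorm_comp_le _ _).trans ?_
  have h1 := (hH k).2.2.1 (x0 + ell k X) (x0 + ell k Y)
  rw [add_sub_add_left_eq_sub, ← map_sub] at h1
  have h2 := (ell k : EE m n →L[ℝ] Phase n).le_opNorm (X - Y)
  calc _ ≤ (Λ * (‖(ell k : EE m n →L[ℝ] Phase n)‖ * ‖X - Y‖)) * ‖(ell k : EE m n →L[ℝ] Phase n)‖ := by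
        refine mul_le_mul_of_nonneg_right (h1.trans ?_) (norm_nonneg _)
        exact mul_le_mul_of_nonneg_left h2 hΛ
    _ = _ := by ring

lemma Rf_bd {m n : ℕ} {Λ : ℝ} {H : ℕ → Phase n → ℝ} (hH : ∀ k, Bd Λ (H k)) (h : ℝ)
    (x0 : Phase n) (Y : EE m n) : |Rf H h x0 Y| ≤ |h| * ((m + 1 : ℕ) * Λ) := by
  unfold Rf
  rw [abs_neg, abs_mul]
  refine mul_le_mul_of_nonneg_left ?_ (abs_nonneg h)
  refine (Finset.abs_sum_le_sum_abs _ _).trans ?_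
  refine (Finset.sum_le_sum (g := fun _ => Λ) fun k _ => (hH k).2.2.2 _).trans ?_
  rw [Finset.sum_const, Finset.card_range, nsmul_eq_mul]

lemma Rf_close {m n : ℕ} {H K : ℕ → Phase n → ℝ} (h δ : ℝ) (hh : 0 ≤ h)
    (x0 : Phase n) (hHK : ∀ k x, |H k x - K k x| ≤ δ) (Y : EE m n) :
    |Rf H h x0 Y - Rf K h x0 Y| ≤ h * ((m + 1 : ℕ) * δ) := by
  unfold Rf
  rw [← neg_sub', abs_neg, ← mul_sub, ← Finset.sum_sub_distrib, abs_mul, abs_of_nonneg hh]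
  refine mul_le_mul_of_nonneg_left ?_ hh
  refine (Finset.abs_sum_le_sum_abs _ _).trans ?_
  refine (Finset.sum_le_sum (g := fun _ => δ) fun k _ => hHK _ _).trans ?_
  rw [Finset.sum_const, Finset.card_range, nsmul_eq_mul]

lemma dRf_apply {m n : ℕ} (H : ℕ → Phase n → ℝ) (h : ℝ) (x0 : Phase n) (Y v : EE m n) :
    dRf H h x0 Y v
      = -(h * ∑ k ∈ Finset.range (m + 1), fderiv ℝ (H k) (x0 + ell k Y) (ell k v)) := by
  unfold dRf
  simp [neg_apply, sum_apply]

lemma crit_apply {m n : ℕ} {Λ : ℝ} {H : ℕ → Phase n → ℝ} (hH : ∀ k, Bd Λ (H k)) (h r ν : ℝ)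
    (x0 : Phase n) (Y : EE m n)
    (hY : ‖fderiv ℝ (fun y => Qf y + r * Rf H h x0 y) Y‖ < ν) (v : EE m n) (hv : ‖v‖ ≤ 1) :
    |inner ℝ Y.fst v.snd + inner ℝ v.fst Y.snd
      - r * h * ∑ k ∈ Finset.range (m + 1), fderiv ℝ (H k) (x0 + ell k Y) (ell k v)| ≤ ν := by
  have h1 : HasFDerivAt (fun y => Qf y + r * Rf H h x0 y)
      (fderiv ℝ (Qf : EE m n → ℝ) Y + r • dRf H h x0 Y) Y :=
    (Qf_contDiff.differentiable two_ne_zero Y).hasFDerivAt.add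
      ((Rf_hasFDerivAt hH h x0 Y).const_mul r)
  rw [h1.fderiv] at hY
  have h2 := (fderiv ℝ (Qf : EE m n → ℝ) Y + r • dRf H h x0 Y).le_opNorm v
  have h3 := h2.trans ((mul_le_of_le_one_right (norm_nonneg _) hv).trans hY.le)
  rw [add_apply, smul_apply, dRf_apply, Qf_fderiv, Real.norm_eq_abs, smul_eq_mul] at h3
  refine le_trans (le_of_eq (congrArg abs ?_)) h3
  ring

lemma crit_D {m n : ℕ} {Λ : ℝ} {H : ℕ → Phase n → ℝ} (hH : ∀ k, Bd Λ (H k)) (h r ν : ℝ)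
    (x0 : Phase n) (Y : EE m n)
    (hY : ‖fderiv ℝ (fun y => Qf y + r * Rf H h x0 y) Y‖ < ν) (k : Fin m) (i : Fin n) :
    |Y.snd (k, i) - r * h * pderivP (H k) i (x0 + ell k Y)| ≤ ν := by
  have h1 := crit_apply hH h r ν x0 Y hY (WithLp.toLp 2 (EuclideanSpace.single (k, i) 1, 0)) (by simp)
  have h2 : ∀ j ∈ Finset.range (m + 1), j ≠ (k : ℕ) → fderiv ℝ (H j) (x0 + ell j Y)
      (ell j (WithLp.toLp 2 (EuclideanSpace.single (k, i) 1, 0) : EE m n)) = 0 := by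
    intro j _ hj
    have : ell j (WithLp.toLp 2 (EuclideanSpace.single (k, i) 1, 0) : EE m n) = 0 := by
      refine Prod.ext (funext fun i' => ?_) (funext fun i' => ?_)
      · rw [ell_fst]
        split_ifs with hjm
        · have : (⟨j, hjm⟩ : Fin m) ≠ k := fun h => hj (by rw [← h])
          simp [this]
        · rfl
      · rw [ell_snd]
        simp
    rw [this, map_zero]
  rw [Finset.sum_eq_single (k : ℕ) h2 (fun hk => absurd (Finset.mem_range.2 (by omega)) hk)] at h1
  have h3 : ell (k : ℕ) (WithLp.toLp 2 (EuclideanSpace.single (k, i) 1, 0) : EE m n)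
      = (Pi.single i 1, 0) := by
    refine Prod.ext (funext fun i' => ?_) (funext fun i' => ?_)
    · rw [ell_fst, dif_pos k.2]
      simp [PiLp.single_apply, Pi.single_apply]
    · rw [ell_snd]
      simp
  rw [h3] at h1
  simpa [EuclideanSpace.inner_single_left, pderivP] using h1

/-- Tail sums of the `q`-derivatives. -/
noncomputable def tailQ {m n : ℕ} (H : ℕ → Phase n → ℝ) (x0 : Phase n) (Y : EE m n) (l : ℕ)
    (i : Fin n) : ℝ :=
  ∑ k ∈ Finset.range (m + 1), if l < k then pderivQ (H k) i (x0 + ell k Y) else 0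

lemma crit_P {m n : ℕ} {Λ : ℝ} {H : ℕ → Phase n → ℝ} (hH : ∀ k, Bd Λ (H k)) (h r ν : ℝ)
    (x0 : Phase n) (Y : EE m n)
    (hY : ‖fderiv ℝ (fun y => Qf y + r * Rf H h x0 y) Y‖ < ν) (l : Fin m) (i : Fin n) :
    |Y.fst (l, i) - r * h * tailQ H x0 Y l i| ≤ ν := by
  have h1 := crit_apply hH h r ν x0 Y hY (WithLp.toLp 2 (0, EuclideanSpace.single (l, i) 1)) (by simp)
  have h3 : ∀ k : ℕ, ell k (WithLp.toLp 2 (0, EuclideanSpace.single (l, i) 1) : EE m n)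
      = if (l : ℕ) < k then (0, Pi.single i 1) else 0 := by
    intro k
    refine Prod.ext (funext fun i' => ?_) (funext fun i' => ?_)
    · rw [ell_fst]
      split_ifs <;> simp
    · rw [ell_snd, Finset.sum_eq_single l]
      · split_ifs <;> simp [PiLp.single_apply, Pi.single_apply]
      · intro b _ hb
        simp [hb]
      · intro h; exact absurd (Finset.mem_univ _) h
  have h4 : ∑ k ∈ Finset.range (m + 1), fderiv ℝ (H k) (x0 + ell k Y)
      (ell k (WithLp.toLp 2 (0, EuclideanSpace.single (l, i) 1) : EE m n)) = tailQ H x0 Y l i := by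
    refine Finset.sum_congr rfl fun k _ => ?_
    rw [h3]
    split_ifs
    · rfl
    · rw [map_zero]
  rw [h4] at h1
  simpa [EuclideanSpace.inner_single_right] using h1

lemma crit_step {m n : ℕ} {Λ : ℝ} {H : ℕ → Phase n → ℝ} (hH : ∀ k, Bd Λ (H k)) (h r ν : ℝ)
    (x0 : Phase n) (Y : EE m n)
    (hY : ‖fderiv ℝ (fun y => Qf y + r * Rf H h x0 y) Y‖ < ν) (k : ℕ) (hk : k < m) :
    ‖(x0 + ell (k + 1) Y) - (x0 + ell k Y) - (r * h) • hv (H (k + 1)) (H k)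
      (x0 + ell (k + 1) Y) (x0 + ell k Y)‖ ≤ 2 * ν := by
  have hν : 0 ≤ ν := (norm_nonneg _).trans hY.le
  have hP : ∀ l, l ≤ m → ∀ i, |(ell l Y).1 i - r * h * tailQ H x0 Y l i| ≤ ν := by
    intro l hl i
    rcases hl.lt_or_eq with hl | hl
    · rw [ell_fst, dif_pos hl]
      exact crit_P hH h r ν x0 Y hY ⟨l, hl⟩ i
    · have h1 : (ell l Y).1 i = 0 := by rw [ell_fst, dif_neg (by omega)]
      have h2 : tailQ H x0 Y l i = 0 := by
        refine Finset.sum_eq_zero fun j hj => ?_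
        have := Finset.mem_range.1 hj
        rw [if_neg (by omega)]
      rw [h1, h2]
      simpa using hν
  have hT : ∀ i, tailQ H x0 Y k i - tailQ H x0 Y (k + 1) i
      = pderivQ (H (k + 1)) i (x0 + ell (k + 1) Y) := by
    intro i
    unfold tailQ
    rw [← Finset.sum_sub_distrib, Finset.sum_eq_single (k + 1)]
    · simp
    · intro j _ hj
      by_cases h1 : k + 1 < j
      · rw [if_pos (by omega), if_pos h1, sub_self]
      · rw [if_neg (by omega), if_neg h1, sub_self]
    · intro hj
      exact absurd (Finset.mem_range.2 (by omega)) hj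
  have hD : ∀ i, (ell (k + 1) Y).2 i - (ell k Y).2 i = Y.snd (⟨k, hk⟩, i) := by
    intro i
    rw [ell_snd, ell_snd, ← Finset.sum_sub_distrib, Finset.sum_eq_single ⟨k, hk⟩]
    · simp
    · intro j _ hj
      have hj' : (j : ℕ) ≠ k := fun h => hj (Fin.ext h)
      by_cases h1 : (j : ℕ) < k
      · rw [if_pos (by omega), if_pos h1, sub_self]
      · rw [if_neg (by omega), if_neg h1, sub_self]
    · intro hj
      exact absurd (Finset.mem_univ _) hj
  rw [add_sub_add_left_eq_sub, Prod.norm_def]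
  have h2ν : 0 ≤ 2 * ν := by linarith
  refine max_le ?_ ?_ <;> rw [pi_norm_le_iff_of_nonneg h2ν] <;> intro i
  · have e : (ell (k + 1) Y - ell k Y - (r * h) • hv (H (k + 1)) (H k)
        (x0 + ell (k + 1) Y) (x0 + ell k Y)).1 i
        = ((ell (k + 1) Y).1 i - r * h * tailQ H x0 Y (k + 1) i)
          - ((ell k Y).1 i - r * h * tailQ H x0 Y k i) := by
      simp only [Prod.fst_sub, Pi.sub_apply, Prod.smul_fst, Pi.smul_apply, smul_eq_mul, hv]
      linear_combination (-(r * h)) * hT i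
    rw [e]
    refine (norm_sub_le _ _).trans ?_
    have h1 := hP (k + 1) hk i
    have h2 := hP k hk.le i
    rw [← Real.norm_eq_abs] at h1 h2
    linarith
  · have e : (ell (k + 1) Y - ell k Y - (r * h) • hv (H (k + 1)) (H k)
        (x0 + ell (k + 1) Y) (x0 + ell k Y)).2 i
        = Y.snd (⟨k, hk⟩, i) - r * h * pderivP (H k) i (x0 + ell k Y) := by
      simp only [Prod.snd_sub, Pi.sub_apply, Prod.smul_snd, Pi.smul_apply, smul_eq_mul, hv]
      rw [hD]
    rw [e]
    have := crit_D hH h r ν x0 Y hY ⟨k, hk⟩ i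
    rw [← Real.norm_eq_abs] at this
    simp only at this
    linarith

lemma crit_dist {m n : ℕ} (x0 : Phase n) (Y : EE m n) (b : ℝ) (hb : 0 ≤ b)
    (hw : ∀ k < m, ‖(x0 + ell (k + 1) Y) - (x0 + ell k Y)‖ ≤ b) (k : ℕ) (hk : k ≤ m) :
    ‖(x0 + ell k Y) - x0‖ ≤ m * b := by
  have key : ∀ a c, a ≤ c → c ≤ m → dist (ell a Y) (ell c Y) ≤ m * b := by
    intro a c hac hc
    refine (dist_le_Ico_sum_of_dist_le (f := fun k => ell k Y) hac (d := fun _ => b) ?_).trans ?_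
    · intro k _ hk2
      rw [dist_comm, dist_eq_norm]
      have := hw k (by omega)
      rwa [add_sub_add_left_eq_sub] at this
    · rw [Finset.sum_const, Nat.card_Ico, nsmul_eq_mul]
      exact mul_le_mul_of_nonneg_right (by exact_mod_cast (by omega)) hb
  have z1 : (ell m Y).1 = 0 := by
    funext i
    rw [ell_fst, dif_neg (by omega)]; rfl
  have z2 : (ell 0 Y).2 = 0 := by
    funext i
    rw [ell_snd]
    simp
  rw [add_sub_cancel_left, Prod.norm_def]
  refine max_le ?_ ?_
  · have h1 := key k m hk le_rfl
    rw [dist_eq_norm] at h1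
    have h2 := (norm_fst_le (ell k Y - ell m Y)).trans h1
    rwa [Prod.fst_sub, z1, sub_zero] at h2
  · have h1 := key 0 k (Nat.zero_le _) hk
    rw [dist_comm, dist_eq_norm] at h1
    have h2 := (norm_snd_le (ell k Y - ell 0 Y)).trans h1
    rwa [Prod.snd_sub, z2, sub_zero] at h2

lemma crit_main {n : ℕ} {Λ : ℝ} {F G : Phase n → ℝ} (hF : Bd Λ F) (hG : Bd Λ G) (M : ℕ)
    (h r s : ℝ) (hh0 : 0 < h) (hN : ((M + 1 : ℕ) : ℝ) * h = 1) (hr0 : 0 ≤ r) (hrs : r ≤ s)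
    (hs : s ≤ 1) (x0 : Phase n) (Y : EE (4 * M + 3) n)
    (hY : ‖fderiv ℝ (fun y => Qf y + r * Rf (Hs F G (M + 1)) h x0 y) Y‖ < h ^ 2) :
    |Rf (Hs F G (M + 1)) h x0 Y - r * h * ∑ i ∈ Finset.range M,
      (poisson F G (x0 + ell (M + 1 + i) Y) + poisson F G (x0 + ell (2 * (M + 1) + i) Y))|
      ≤ 42 * (Λ + 2) ^ 3 * h ∧
    ∀ k ≤ 4 * M + 3, ‖(x0 + ell k Y) - x0‖ ≤ 4 * s * Λ + 8 * h := by
  have hΛ := hF.nonneg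
  have hH := Hs_Bd hF hG (M + 1)
  have hst := crit_step hH h r (h ^ 2) x0 Y hY
  have hτ0 : 0 ≤ r * h := by positivity
  have hτ : r * h ≤ h := mul_le_of_le_one_left hh0.le (hrs.trans hs)
  have hM0 : (0 : ℝ) ≤ M := Nat.cast_nonneg M
  push_cast at hN
  have hh1 : h ≤ 1 := by nlinarith
  constructor
  · have := seg_action hF hG hτ0 hτ hh1 (M + 1) M rfl (by push_cast; exact hN)
      (fun k => x0 + ell k Y) (fun k hk => hst k (by omega))
    exact this
  · intro k hk
    have hb : ∀ k < 4 * M + 3, ‖(x0 + ell (k + 1) Y) - (x0 + ell k Y)‖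
        ≤ r * h * Λ + 2 * h ^ 2 := by
      intro k hk
      have h1 := hst k hk
      set w' := x0 + ell (k + 1) Y
      set w := x0 + ell k Y
      have h2 := norm_add_le (w' - w - (r * h) • hv (Hs F G (M + 1) (k + 1)) (Hs F G (M + 1) k) w' w)
        ((r * h) • hv (Hs F G (M + 1) (k + 1)) (Hs F G (M + 1) k) w' w)
      rw [sub_add_cancel, norm_smul, Real.norm_of_nonneg hτ0] at h2
      have h3 := mul_le_mul_of_nonneg_left (hv_norm (hH (k + 1)) (hH k) w' w) hτ0
      linarith
    refine (crit_dist x0 Y _ (by positivity) hb k hk).trans ?_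
    have h4 : r * h * Λ ≤ s * h * Λ := by gcongr
    have h5 : 0 ≤ s * h * Λ + 2 * h ^ 2 := by
      have := hr0.trans hrs
      positivity
    calc ((4 * M + 3 : ℕ) : ℝ) * (r * h * Λ + 2 * h ^ 2)
        ≤ (4 * (M + 1)) * (s * h * Λ + 2 * h ^ 2) := by
          push_cast
          refine mul_le_mul (by linarith) (by linarith) (by positivity) (by positivity)
      _ = 4 * s * Λ + 8 * h := by
          linear_combination (4 * s * Λ + 8 * h) * hN

lemma crit_upper {n : ℕ} {Λ : ℝ} {F G : Phase n → ℝ} (hF : Bd Λ F) (hG : Bd Λ G) (M : ℕ)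
    (h r s C : ℝ) (hh0 : 0 < h) (hN : ((M + 1 : ℕ) : ℝ) * h = 1) (hr0 : 0 ≤ r) (hrs : r ≤ s)
    (hs : s ≤ 1) (x0 : Phase n) (hC0 : 0 ≤ C) (hC : ∀ x, poisson F G x ≤ C)
    (Y : EE (4 * M + 3) n)
    (hY : ‖fderiv ℝ (fun y => Qf y + r * Rf (Hs F G (M + 1)) h x0 y) Y‖ < h ^ 2) :
    Rf (Hs F G (M + 1)) h x0 Y ≤ 2 * r * C + 42 * (Λ + 2) ^ 3 * h := by
  have h1 := (crit_main hF hG M h r s hh0 hN hr0 hrs hs x0 Y hY).1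
  have h2 : ∑ i ∈ Finset.range M, (poisson F G (x0 + ell (M + 1 + i) Y)
      + poisson F G (x0 + ell (2 * (M + 1) + i) Y)) ≤ M * (2 * C) := by
    refine (Finset.sum_le_sum (g := fun _ => 2 * C) fun i _ => ?_).trans ?_
    · linarith [hC (x0 + ell (M + 1 + i) Y), hC (x0 + ell (2 * (M + 1) + i) Y)]
    · rw [Finset.sum_const, Finset.card_range, nsmul_eq_mul]
  have h3 := mul_le_mul_of_nonneg_left h2 (show 0 ≤ r * h by positivity)
  push_cast at hN
  have h4 : r * h * (M * (2 * C)) ≤ 2 * r * C := by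
    have e : r * h * (M * (2 * C)) = 2 * r * C - 2 * r * C * h := by
      linear_combination (2 * r * C) * hN
    have : 0 ≤ 2 * r * C * h := by positivity
    linarith
  linarith [(abs_le.1 h1).2]

lemma crit_lower {n : ℕ} {Λ : ℝ} {F G : Phase n → ℝ} (hF : Bd Λ F) (hG : Bd Λ G) (M : ℕ)
    (h r s A ρ : ℝ) (hh0 : 0 < h) (hN : ((M + 1 : ℕ) : ℝ) * h = 1) (hr0 : 0 ≤ r) (hrs : r ≤ s)
    (hs : s ≤ 1) (x0 : Phase n) (hA0 : 0 ≤ A) (hρ : 4 * s * Λ + 8 * h < ρ)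
    (hA : ∀ x, ‖x - x0‖ < ρ → A ≤ poisson F G x)
    (Y : EE (4 * M + 3) n)
    (hY : ‖fderiv ℝ (fun y => Qf y + r * Rf (Hs F G (M + 1)) h x0 y) Y‖ < h ^ 2) :
    2 * r * A - (42 * (Λ + 2) ^ 3 * h + 2 * A * h) ≤ Rf (Hs F G (M + 1)) h x0 Y := by
  obtain ⟨h1, hd⟩ := crit_main hF hG M h r s hh0 hN hr0 hrs hs x0 Y hY
  have h2 : M * (2 * A) ≤ ∑ i ∈ Finset.range M, (poisson F G (x0 + ell (M + 1 + i) Y)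
      + poisson F G (x0 + ell (2 * (M + 1) + i) Y)) := by
    refine le_trans ?_ (Finset.sum_le_sum (f := fun _ => 2 * A) fun i hi => ?_)
    · rw [Finset.sum_const, Finset.card_range, nsmul_eq_mul]
    · have hi' := Finset.mem_range.1 hi
      linarith [hA (x0 + ell (M + 1 + i) Y) ((hd _ (by omega)).trans_lt hρ),
        hA (x0 + ell (2 * (M + 1) + i) Y) ((hd _ (by omega)).trans_lt hρ)]
  have h3 := mul_le_mul_of_nonneg_left h2 (show 0 ≤ r * h by positivity)
  push_cast at hN
  have h4 : 2 * r * A - 2 * A * h ≤ r * h * (M * (2 * A)) := by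
    have e : r * h * (M * (2 * A)) = 2 * r * A - 2 * r * A * h := by
      linear_combination (2 * r * A) * hN
    have : r * (2 * A * h) ≤ 1 * (2 * A * h) :=
      mul_le_mul_of_nonneg_right (hrs.trans hs) (by positivity)
    linarith
  linarith [(abs_le.1 h1).1]

lemma poisson_continuous {n : ℕ} {F G : Phase n → ℝ} (hF : SmoothCpt F) (hG : SmoothCpt G) :
    Continuous (poisson F G) := by
  have key : ∀ K : Phase n → ℝ, SmoothCpt K → ∀ v, Continuous fun x => fderiv ℝ K x v :=
    fun K hK v => (hK.1.continuous_fderiv (by simp)).clm_apply continuous_const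
  unfold poisson pderivP pderivQ
  exact continuous_finsetSum _ fun i _ =>
    ((key F hF _).mul (key G hG _)).sub ((key F hF _).mul (key G hG _))

lemma Hs_close {n : ℕ} {F G F' G' : Phase n → ℝ} {δ : ℝ} (hF : ∀ x, |F' x - F x| ≤ δ)
    (hG : ∀ x, |G' x - G x| ≤ δ) (N k : ℕ) (x : Phase n) :
    |Hs F G N k x - Hs F' G' N k x| ≤ δ := by
  have h1 := hF x
  have h2 := hG x
  rw [abs_le] at h1 h2 ⊢
  unfold Hs
  split_ifs <;> constructor <;> linarith [h1.1, h1.2, h2.1, h2.2]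

lemma core {n : ℕ} {F G : Phase n → ℝ} (hF : SmoothCpt F) (hG : SmoothCpt G) (x0 : Phase n)
    (ε : ℝ) (hε : 0 < ε) : ∃ δ > (0 : ℝ), ∀ F' G' : Phase n → ℝ, SmoothCpt F' → SmoothCpt G' →
      (∀ x, |F' x - F x| ≤ δ) → (∀ x, |G' x - G x| ≤ δ) → ∀ C, 0 ≤ C →
      (∀ x, poisson F' G' x ≤ C) → poisson F G x0 - ε < C := by
  set A := poisson F G x0 with hA
  by_cases hAε : A < ε
  · exact ⟨1, one_pos, fun F' G' _ _ _ _ C hC _ => by linarith⟩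
  rw [not_lt] at hAε
  obtain ⟨Λ1, hΛ1⟩ := exists_Bd hF
  obtain ⟨Λ2, hΛ2⟩ := exists_Bd hG
  set Λ := max Λ1 Λ2
  have bF : Bd Λ F := hΛ1.mono (le_max_left _ _)
  have bG : Bd Λ G := hΛ2.mono (le_max_right _ _)
  have hΛ0 := bF.nonneg
  obtain ⟨ρ, hρ0, hρ⟩ := Metric.continuous_iff.1 (poisson_continuous hF hG) x0 (ε / 4)
    (by positivity)
  set s := min 1 (ρ / (16 * (Λ + 1))) with hs
  have hs0 : 0 < s := lt_min one_pos (by positivity)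
  have hs1 : s ≤ 1 := min_le_left _ _
  have hsρ : 4 * s * Λ < ρ / 2 := by
    have h1 : s ≤ ρ / (16 * (Λ + 1)) := min_le_right _ _
    rw [le_div_iff₀ (by positivity)] at h1
    nlinarith
  have hδ0 : 0 < s * ε / 32 := by positivity
  refine ⟨s * ε / 32, hδ0, fun F' G' hF' hG' hFF hGG C hC hCb => ?_⟩
  by_contra hcon
  rw [not_lt] at hcon
  obtain ⟨L1, hL1⟩ := exists_Bd hF'
  obtain ⟨L2, hL2⟩ := exists_Bd hG'
  set L := max L1 L2
  have bF' : Bd L F' := hL1.mono (le_max_left _ _)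
  have bG' : Bd L G' := hL2.mono (le_max_right _ _)
  have hL0 := bF'.nonneg
  set A1 := A - ε / 4 with hA1
  have hA10 : 0 ≤ A1 := by linarith
  set η := s * ε / 16 with hη
  have hη0 : 0 < η := by positivity
  set T := 42 * (Λ + 2) ^ 3 + 2 * A1 + 42 * (L + 2) ^ 3 + 1 with hT
  have hT0 : 0 < T := by positivity
  obtain ⟨M, hM⟩ := exists_nat_one_div_lt (show 0 < min (ρ / 16) (η / T) by positivity)
  set h : ℝ := 1 / ((M : ℝ) + 1) with hh
  have hh0 : 0 < h := by positivity
  have hN : ((M + 1 : ℕ) : ℝ) * h = 1 := by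
    rw [hh]; push_cast; field_simp
  have h1 : h < ρ / 16 := hM.trans_le (min_le_left _ _)
  have h2 : h * T < η := by
    have := hM.trans_le (min_le_right _ _)
    rwa [lt_div_iff₀ hT0] at this
  have t1 : 0 ≤ 42 * (Λ + 2) ^ 3 * h := by positivity
  have t2 : 0 ≤ 42 * (L + 2) ^ 3 * h := by positivity
  have t3 : 0 ≤ 2 * A1 * h := by positivity
  have h3 : 42 * (Λ + 2) ^ 3 * h + 2 * A1 * h ≤ η := by rw [hT] at h2; nlinarith
  have h4 : 42 * (L + 2) ^ 3 * h ≤ η := by rw [hT] at h2; nlinarith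
  have hball : ∀ x, ‖x - x0‖ < ρ → A1 ≤ poisson F G x := by
    intro x hx
    have := hρ x (by rwa [dist_eq_norm])
    rw [Real.dist_eq, abs_lt] at this
    linarith [this.1]
  let j : WW (4 * M + 3) n → EE (4 * M + 3) n := fun x => WithLp.toLp 2 (x, -x)
  have hj : ContDiff ℝ 1 j :=
    (WithLp.prodContinuousLinearEquiv 2 ℝ (WW (4 * M + 3) n) (WW (4 * M + 3) n)).symm.contDiff.comp
      (contDiff_id.prodMk contDiff_id.neg)
  have l0 : Lev j Qf 0 := by
    refine ⟨j, hj, ⟨0, fun x => by simp⟩, fun x => ?_⟩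
    change inner ℝ x (-x) ≤ 0
    rw [inner_neg_right, neg_nonpos]
    exact real_inner_self_nonneg
  obtain ⟨LR', hLR'0, hLR'⟩ := Rf_lip (m := 4 * M + 3) (Hs_Bd bF' bG' (M + 1)) h x0
  obtain ⟨LR, hLR0, hLR⟩ := Rf_lip (m := 4 * M + 3) (Hs_Bd bF bG (M + 1)) h x0
  have l1 := lev_up j Qf (Rf (Hs F' G' (M + 1)) h x0) Qf_contDiff
    (Rf_contDiff (Hs_Bd bF' bG' (M + 1)) h x0) 2 LR' _ Qf_lip hLR' two_pos.le hLR'0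
    (by positivity) (Rf_bd (Hs_Bd bF' bG' (M + 1)) h x0) s (h ^ 2) C η 0 hs0 (by positivity) hC
    hη0.le (fun r hr0 hrs Y hY =>
      (crit_upper bF' bG' M h r s C hh0 hN hr0 hrs hs1 x0 hC hCb Y hY).trans (by linarith)) l0
  have l2 := lev_mono j _ (fun Y => Qf Y + s * Rf (Hs F G (M + 1)) h x0 Y) _ (s ^ 2 * ε / 8)
    (fun Y => by
      have := (abs_le.1 (Rf_close (m := 4 * M + 3) h _ hh0.le x0
        (fun k x => Hs_close hFF hGG (M + 1) k x) Y)).2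
      have e : h * (((4 * M + 3 + 1 : ℕ) : ℝ) * (s * ε / 32)) = s * ε / 8 := by
        push_cast at hN ⊢
        linear_combination (s * ε / 8) * hN
      rw [e] at this
      have := mul_le_mul_of_nonneg_left this hs0.le
      nlinarith) l1
  have l3 := lev_down j Qf (Rf (Hs F G (M + 1)) h x0) Qf_contDiff
    (Rf_contDiff (Hs_Bd bF bG (M + 1)) h x0) 2 LR _ Qf_lip hLR two_pos.le hLR0
    (by positivity) (Rf_bd (Hs_Bd bF bG (M + 1)) h x0) s (h ^ 2) A1 η _ hs0 (by positivity) hA10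
    hη0.le (fun r hr0 hrs Y hY => le_trans (by linarith)
      (crit_lower bF bG M h r s A1 ρ hh0 hN hr0 hrs hs1 x0 hA10 (by linarith) hball Y hY)) l2
  have l4 := lev_hyperbolic _ l3
  have e : 0 + s ^ 2 * C + s * η + s ^ 2 * ε / 8 - s ^ 2 * A1 + s * η
      = s ^ 2 * (C - A + ε / 2) := by
    rw [hη, hA1]; ring
  rw [e] at l4
  have : 0 < s ^ 2 := by positivity
  nlinarith

lemma bdd_of_cpt {n : ℕ} {F : Phase n → ℝ} (hF : Continuous F) (hc : HasCompactSupport F) :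
    BddAbove (Set.range fun x => |F x|) := by
  obtain ⟨B, hB⟩ := hc.exists_bound_of_continuous hF
  exact ⟨B, by rintro _ ⟨x, rfl⟩; exact hB x⟩

lemma poisson_cpt {n : ℕ} {F G : Phase n → ℝ} (hF : SmoothCpt F) :
    HasCompactSupport (poisson F G) := by
  refine (hF.2.fderiv ℝ).mono fun x hx => ?_
  rw [Function.mem_support] at hx ⊢
  intro h0
  apply hx
  unfold poisson pderivP pderivQ
  rw [h0]
  simp

/-- Lower semicontinuity of `‖{F,G}‖` in the uniform norm: for every `ε > 0` there is
`δ > 0` such that any `F', G' ∈ C_c^∞(ℝ^{2n})` that are `δ`-close to `F, G` in the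
uniform norm satisfy `‖{F',G'}‖ > ‖{F,G}‖ − ε`. -/
theorem norm_poisson_lower_semicontinuous (n : ℕ) (hn : 1 ≤ n) (F G : Phase n → ℝ)
    (hF : SmoothCpt F) (hG : SmoothCpt G) :
    ∀ ε > (0 : ℝ), ∃ δ > (0 : ℝ), ∀ F' G' : Phase n → ℝ,
      SmoothCpt F' → SmoothCpt G' →
      unif (fun x => F' x - F x) < δ → unif (fun x => G' x - G x) < δ →
      unif (poisson F' G') > unif (poisson F G) - ε := by
  intro ε hε
  have hsub : ∀ K K' : Phase n → ℝ, SmoothCpt K → SmoothCpt K' → ∀ δ,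
      unif (fun x => K' x - K x) < δ → ∀ x, |K' x - K x| ≤ δ := by
    intro K K' hK hK' δ h x
    have hb := bdd_of_cpt (hK'.1.continuous.sub hK.1.continuous) (hK'.2.sub hK.2)
    exact (le_ciSup hb x).trans h.le
  have hpb : ∀ K K' : Phase n → ℝ, SmoothCpt K → SmoothCpt K' → ∀ x,
      |poisson K K' x| ≤ unif (poisson K K') := fun K K' hK hK' x =>
    le_ciSup (bdd_of_cpt (poisson_continuous hK hK') (poisson_cpt hK)) x
  obtain ⟨x0, hx0⟩ := exists_lt_of_lt_ciSup
    (show unif (poisson F G) - ε / 2 < ⨆ x, |poisson F G x| by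
      change _ < unif (poisson F G)
      linarith)
  rcases le_total 0 (poisson F G x0) with hp | hp
  · rw [abs_of_nonneg hp] at hx0
    obtain ⟨δ, hδ, key⟩ := core hF hG x0 (ε / 2) (by positivity)
    refine ⟨δ, hδ, fun F' G' hF' hG' h1 h2 => ?_⟩
    have := key F' G' hF' hG' (hsub F F' hF hF' δ h1) (hsub G G' hG hG' δ h2)
      (unif (poisson F' G')) ((abs_nonneg _).trans (hpb F' G' hF' hG' 0))
      (fun x => (le_abs_self _).trans (hpb F' G' hF' hG' x))
    linarith
  · rw [abs_of_nonpos hp, ← poisson_swap] at hx0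
    obtain ⟨δ, hδ, key⟩ := core hG hF x0 (ε / 2) (by positivity)
    refine ⟨δ, hδ, fun F' G' hF' hG' h1 h2 => ?_⟩
    have := key G' F' hG' hF' (hsub G G' hG hG' δ h2) (hsub F F' hF hF' δ h1)
      (unif (poisson F' G')) ((abs_nonneg _).trans (hpb F' G' hF' hG' 0))
      (fun x => by
        rw [poisson_swap]
        exact (neg_le_abs _).trans (hpb F' G' hF' hG' x))
    linarith
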